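/- For ℙ-almost every ω the limit Φ(ω) := lim_{n→∞} (φ(n,ω)ᵀφ(n,ω))^{1/(2n)} exists as a symmetric positive-definite matrix, and the following holds: let e^{λ_p(ω)} < ⋯ < e^{λ_1(ω)} be the distinct eigenvalues of Φ(ω) with eigenspaces U_p(ω),…,U_1(ω), and set V_{p+1}(ω) := {0} and V_i(ω) := U_p(ω) ⊕ ⋯ ⊕ U_i(ω) for i = 1,…,p. Then for every x ∈ ℝ^d∖{0} the Lyapunov exponent λ(ω,x) := lim_{n→∞} (1/n) log|φ(n,ω)x| exists, and λ(ω,x) = λ_i(ω) if and only if x ∈ V_i(ω)∖V_{i+1}(ω); equivalently, V_i(ω) = {x ∈ ℝ^d : λ(ω,x) ≤ λ_i(ω)} (with λ(ω,0) := −∞). -/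

import Mathlib

open Matrix Filter Topology MeasureTheory

noncomputable section

/-- The Euclidean norm of a vector in `ℝ^d`. -/
def eNorm {ι : Type*} [Fintype ι] (x : ι → ℝ) : ℝ := Real.sqrt (∑ i, x i ^ 2)

/-- The operator norm of a matrix, with respect to the Euclidean norm. -/
def opNorm {ι : Type*} [Fintype ι] (M : Matrix ι ι ℝ) : ℝ :=
  ⨆ x : {x : ι → ℝ // eNorm x ≤ 1}, eNorm (M *ᵥ (x : ι → ℝ))

set_option linter.unusedSectionVars false

namespace MET

section Kingman

variable {Ω : Type*} [MeasurableSpace Ω]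

lemma mp_integral {ν : Measure Ω} {S : Ω → Ω} (hS : MeasurePreserving S ν ν) {g : Ω → ℝ}
    (hg : Integrable g ν) : ∫ x, g (S x) ∂ν = ∫ x, g x ∂ν := by
  have h := integral_map (μ := ν) (φ := S) hS.measurable.aemeasurable (f := g)
    (by rw [hS.map_eq]; exact hg.1)
  rw [hS.map_eq] at h
  exact h.symm

lemma mp_integrable {ν : Measure Ω} {S : Ω → Ω} (hS : MeasurePreserving S ν ν) {g : Ω → ℝ}
    (hg : Integrable g ν) : Integrable (fun x => g (S x)) ν :=
  hS.integrable_comp_of_integrable hg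

lemma le_sum (T : Ω → Ω) (f : ℕ → Ω → ℝ) (g : Ω → ℝ)
    (hsub : ∀ m n x, 1 ≤ m → 1 ≤ n → f (m + n) x ≤ f m x + f n (T^[m] x))
    (h1 : ∀ x, f 1 x ≤ g x) : ∀ n, 1 ≤ n → ∀ x, f n x ≤ ∑ k ∈ Finset.range n, g (T^[k] x) := by
  intro n hn
  induction n, hn using Nat.le_induction with
  | base => intro x; simpa using h1 x
  | succ n hn ih =>
    intro x
    rw [Finset.sum_range_succ]
    have := hsub n 1 x hn le_rfl
    have := ih x
    have := h1 (T^[n] x)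
    linarith

lemma greedy (T : Ω → Ω) (f : ℕ → Ω → ℝ) (g : Ω → ℝ) (hg : ∀ x, 0 ≤ g x)
    (hsub : ∀ m n x, 1 ≤ m → 1 ≤ n → f (m + n) x ≤ f m x + f n (T^[m] x))
    (h1 : ∀ x, f 1 x ≤ g x) (L : ℕ) (hL : 1 ≤ L) (B : Set Ω)
    (hB : ∀ x, x ∉ B → ∃ l, 1 ≤ l ∧ l ≤ L ∧ f l x ≤ 0) :
    ∀ n, 1 ≤ n → ∀ x, f n x ≤ ∑ k ∈ Finset.range n, B.indicator g (T^[k] x)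
      + ∑ k ∈ Finset.Ico (n - L) n, g (T^[k] x) := by
  intro n
  induction n using Nat.strong_induction_on with
  | _ n ih =>
  intro hn x
  have hBg : ∀ y, 0 ≤ B.indicator g y := fun y => Set.indicator_nonneg (fun z _ => hg z) y
  have key : ∀ l, 1 ≤ l → l ≤ L → l < n → (∑ k ∈ Finset.range (n-l), B.indicator g (T^[k] (T^[l] x))
      + ∑ k ∈ Finset.Ico (n - l - L) (n-l), g (T^[k] (T^[l] x))) ≤
      ∑ k ∈ Finset.Ico l n, B.indicator g (T^[k] x)
      + ∑ k ∈ Finset.Ico (n - L) n, g (T^[k] x) := by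
    intro l h1l hlL hln
    simp only [← Function.iterate_add_apply]
    rw [Finset.range_eq_Ico, Finset.sum_Ico_add' (fun k => B.indicator g (T^[k] x)),
      Finset.sum_Ico_add' (fun k => g (T^[k] x))]
    have e : n - l + l = n := by omega
    rw [e, zero_add]
    refine add_le_add le_rfl ?_
    apply Finset.sum_le_sum_of_subset_of_nonneg
    · apply Finset.Ico_subset_Ico_left; omega
    · intros; exact hg _
  rcases le_or_gt n L with hnL | hnL
  · have h := le_sum T f g hsub h1 n hn x
    have e : n - L = 0 := by omega
    rw [e, ← Finset.range_eq_Ico]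
    have : 0 ≤ ∑ k ∈ Finset.range n, B.indicator g (T^[k] x) :=
      Finset.sum_nonneg (fun _ _ => hBg _)
    linarith
  · have hsplit : ∀ l, l < n → ∑ k ∈ Finset.range n, B.indicator g (T^[k] x) =
        ∑ k ∈ Finset.range l, B.indicator g (T^[k] x)
        + ∑ k ∈ Finset.Ico l n, B.indicator g (T^[k] x) := by
      intro l hl
      rw [Finset.sum_range_add_sum_Ico _ hl.le]
    by_cases hx : x ∈ B
    · have h2 := hsub 1 (n-1) x le_rfl (by omega)
      rw [show 1 + (n-1) = n by omega] at h2
      have h3 := ih (n-1) (by omega) (by omega) (T^[1] x)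
      have h4 := key 1 le_rfl hL (by omega)
      rw [hsplit 1 (by omega)]
      have h5 : ∑ k ∈ Finset.range 1, B.indicator g (T^[k] x) = g x := by simp [hx]
      have := h1 x
      linarith
    · obtain ⟨l, hl1, hlL, hl⟩ := hB x hx
      have h2 := hsub l (n-l) x hl1 (by omega)
      rw [show l + (n-l) = n by omega] at h2
      have h3 := ih (n-l) (by omega) (by omega) (T^[l] x)
      have h4 := key l hl1 hlL (by omega)
      rw [hsplit l (by omega)]
      have : 0 ≤ ∑ k ∈ Finset.range l, B.indicator g (T^[k] x) :=
        Finset.sum_nonneg (fun _ _ => hBg _)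
      linarith

lemma lemma1 (ν : Measure Ω) [IsFiniteMeasure ν] (T : Ω → Ω) (hT : MeasurePreserving T ν ν)
    (f : ℕ → Ω → ℝ) (g : Ω → ℝ) (hg : ∀ x, 0 ≤ g x) (hgi : Integrable g ν)
    (hfm : ∀ n, Measurable (f n)) (hfi : ∀ n, 1 ≤ n → Integrable (f n) ν)
    (hsub : ∀ m n x, 1 ≤ m → 1 ≤ n → f (m + n) x ≤ f m x + f n (T^[m] x))
    (h1 : ∀ x, f 1 x ≤ g x) (hz : ∀ᵐ x ∂ν, ∃ n, 1 ≤ n ∧ f n x ≤ 0) (ε : ℝ) (hε : 0 < ε) :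
    ∃ N, 1 ≤ N ∧ ∀ n, N ≤ n → ∫ x, f n x ∂ν ≤ n * ε := by
  let B : ℕ → Set Ω := fun L => {x | ∀ l, 1 ≤ l → l ≤ L → 0 < f l x}
  have hBm : ∀ L, MeasurableSet (B L) := by
    intro L
    have : B L = ⋂ l, ⋂ (_ : 1 ≤ l), ⋂ (_ : l ≤ L), {x | 0 < f l x} := by
      ext x; simp [B]
    rw [this]
    refine MeasurableSet.iInter fun l => MeasurableSet.iInter fun _ => MeasurableSet.iInter fun _ =>
      measurableSet_lt measurable_const (hfm l)
  have hBa : Antitone B := fun L L' h x hx l h1 h2 => hx l h1 (h2.trans h)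
  have hlim := tendsto_setIntegral_of_antitone (μ := ν) (f := g) hBm hBa ⟨0, hgi.integrableOn⟩
  have hnull : ν (⋂ n, B n) = 0 := by
    refine measure_mono_null ?_ hz
    intro x hx
    simp only [Set.mem_iInter] at hx
    simp only [Set.mem_compl_iff, Set.mem_ofPred_eq, not_exists, not_and, not_le]
    intro n hn
    exact hx n n hn le_rfl
  rw [Measure.restrict_eq_zero.mpr hnull, integral_zero_measure] at hlim
  obtain ⟨L, hL1, hL⟩ : ∃ L, 1 ≤ L ∧ ∫ x in B L, g x ∂ν < ε / 2 := by
    have h := (hlim.eventually (gt_mem_nhds (show 0 < ε/2 by linarith))).and (eventually_ge_atTop 1)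
    obtain ⟨L, h⟩ := h.exists
    exact ⟨L, h.2, h.1⟩
  have hgr := greedy T f g hg hsub h1 L hL1 (B L) (by
    intro x hx
    simp only [B, Set.mem_ofPred_eq, not_forall, not_lt] at hx
    obtain ⟨l, a, b, c⟩ := hx
    exact ⟨l, a, b, c⟩)
  have hBi : Integrable ((B L).indicator g) ν := hgi.indicator (hBm L)
  have hint : ∀ n, 1 ≤ n → ∫ x, f n x ∂ν ≤ n * ∫ x in B L, g x ∂ν + L * ∫ x, g x ∂ν := by
    intro n hn
    have i1 : ∀ k ∈ Finset.range n, Integrable (fun x => (B L).indicator g (T^[k] x)) ν :=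
      fun k _ => mp_integrable (hT.iterate k) hBi
    have i2 : ∀ k ∈ Finset.Ico (n-L) n, Integrable (fun x => g (T^[k] x)) ν :=
      fun k _ => mp_integrable (hT.iterate k) hgi
    calc ∫ x, f n x ∂ν ≤ ∫ x, (∑ k ∈ Finset.range n, (B L).indicator g (T^[k] x)
          + ∑ k ∈ Finset.Ico (n - L) n, g (T^[k] x)) ∂ν :=
          integral_mono (hfi n hn)
            ((integrable_finsetSum _ i1).add (integrable_finsetSum _ i2)) (hgr n hn)
      _ = ∑ k ∈ Finset.range n, ∫ x in B L, g x ∂ν + ∑ k ∈ Finset.Ico (n-L) n, ∫ x, g x ∂ν := by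
          rw [integral_add (integrable_finsetSum _ i1) (integrable_finsetSum _ i2),
            integral_finsetSum _ i1, integral_finsetSum _ i2]
          congr 1
          · refine Finset.sum_congr rfl fun k _ => ?_
            rw [mp_integral (hT.iterate k) hBi, integral_indicator (hBm L)]
          · refine Finset.sum_congr rfl fun k _ => ?_
            rw [mp_integral (hT.iterate k) hgi]
      _ ≤ _ := by
          simp only [Finset.sum_const, Finset.card_range, Nat.card_Ico, nsmul_eq_mul]
          have : 0 ≤ ∫ x, g x ∂ν := integral_nonneg hg
          have : ((n - (n - L) : ℕ) : ℝ) ≤ L := by exact_mod_cast (by omega)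
          gcongr
  obtain ⟨N, hN⟩ := exists_nat_gt (L * (∫ x, g x ∂ν) / (ε/2))
  refine ⟨N + 1, by omega, fun n hn => ?_⟩
  have h2 := hint n (by omega)
  have h3 : L * (∫ x, g x ∂ν) ≤ n * (ε / 2) := by
    rw [div_lt_iff₀ (by linarith)] at hN
    have : (N:ℝ) ≤ n := by exact_mod_cast (by omega)
    nlinarith
  have h4 : n * ∫ x in B L, g x ∂ν ≤ n * (ε/2) := by gcongr
  linarith

lemma lemma1' (ν : Measure Ω) [IsFiniteMeasure ν] (T : Ω → Ω) (hT : MeasurePreserving T ν ν)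
    (f : ℕ → Ω → ℝ) (g : Ω → ℝ) (hg : ∀ x, 0 ≤ g x) (hgi : Integrable g ν)
    (hfm : ∀ n, Measurable (f n)) (hfi : ∀ n, 1 ≤ n → Integrable (f n) ν)
    (hsub : ∀ m n x, 1 ≤ m → 1 ≤ n → f (m + n) x ≤ f m x + f n (T^[m] x))
    (h1 : ∀ x, f 1 x ≤ g x) (a : ℝ) (hz : ∀ᵐ x ∂ν, ∃ n, 1 ≤ n ∧ f n x ≤ n * a)
    (ε : ℝ) (hε : 0 < ε) :
    ∃ N, 1 ≤ N ∧ ∀ n, N ≤ n → ∫ x, f n x ∂ν ≤ n * (a * ν.real Set.univ + ε) := by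
  obtain ⟨N, hN1, hN⟩ := lemma1 ν T hT (fun n x => f n x - n * a) (fun x => g x + |a|)
    (fun x => add_nonneg (hg x) (abs_nonneg a)) (hgi.add (integrable_const _))
    (fun n => (hfm n).sub_const _) (fun n hn => (hfi n hn).sub (integrable_const _))
    (by
      intro m n x hm hn
      have := hsub m n x hm hn
      push_cast
      linarith)
    (by
      intro x
      have := h1 x
      have := neg_abs_le a
      simp only [Nat.cast_one]
      linarith)
    (by
      filter_upwards [hz] with x ⟨n, hn, h⟩
      exact ⟨n, hn, by linarith⟩) ε hε
  refine ⟨N, hN1, fun n hn => ?_⟩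
  have h := hN n hn
  rw [integral_sub (hfi n (hN1.trans hn)) (integrable_const _), integral_const] at h
  simp only [smul_eq_mul] at h
  linarith

lemma sum_add_iter (T : Ω → Ω) (h : Ω → ℝ) (m n : ℕ) (x : Ω) :
    ∑ k ∈ Finset.range (m+n), h (T^[k] x) = ∑ k ∈ Finset.range m, h (T^[k] x)
      + ∑ k ∈ Finset.range n, h (T^[k] (T^[m] x)) := by
  rw [Finset.sum_range_add]
  congr 1
  refine Finset.sum_congr rfl fun k _ => ?_
  rw [← Function.iterate_add_apply, add_comm]

lemma lemma2 (ν : Measure Ω) [IsFiniteMeasure ν] (T : Ω → Ω) (hT : MeasurePreserving T ν ν)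
    (h : Ω → ℝ) (hm : Measurable h) (hi : Integrable h ν) (a : ℝ)
    (hz : ∀ᵐ x ∂ν, ∃ n, 1 ≤ n ∧ ∑ k ∈ Finset.range n, h (T^[k] x) ≤ n * a) :
    ∫ x, h x ∂ν ≤ a * ν.real Set.univ := by
  refine le_of_forall_pos_le_add fun ε hε => ?_
  have ii : ∀ n, ∀ k ∈ Finset.range n, Integrable (fun x => h (T^[k] x)) ν :=
    fun n k _ => mp_integrable (hT.iterate k) hi
  obtain ⟨N, hN1, hN⟩ := lemma1' ν T hT (fun n x => ∑ k ∈ Finset.range n, h (T^[k] x))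
    (fun x => |h x|) (fun x => abs_nonneg _) hi.abs
    (fun n => Finset.measurable_sum _ fun k _ => hm.comp (hT.iterate k).measurable)
    (fun n _ => integrable_finsetSum _ (ii n))
    (fun m n x _ _ => (sum_add_iter T h m n x).le)
    (fun x => by simpa using le_abs_self _) a hz ε hε
  have h3 := hN N le_rfl
  rw [integral_finsetSum _ (ii N), Finset.sum_congr rfl
    (fun k _ => mp_integral (hT.iterate k) hi)] at h3
  simp only [Finset.sum_const, Finset.card_range, nsmul_eq_mul] at h3
  have : (0:ℝ) < N := by exact_mod_cast hN1
  exact le_of_mul_le_mul_left h3 this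

/-- strictly below `a` frequently -/
def PB (u : ℕ → ℝ) (a : ℝ) : Prop := ∃ q : ℚ, (q:ℝ) < a ∧ ∃ᶠ n : ℕ in atTop, u n < n * q

lemma PB_shift1 (u v : ℕ → ℝ) (C a : ℝ) (h : ∀ n, 1 ≤ n → u (n+1) ≤ v n + C) (hv : PB v a) :
    PB u a := by
  obtain ⟨q, hq, hf⟩ := hv
  obtain ⟨r, hr1, hr2⟩ := exists_rat_btwn hq
  refine ⟨r, hr2, ?_⟩
  rw [frequently_atTop] at hf ⊢
  intro N
  obtain ⟨M, hM⟩ := exists_nat_gt ((C - r) / (r - q))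
  obtain ⟨n, hn, hlt⟩ := hf (N + M + 1)
  refine ⟨n + 1, by omega, ?_⟩
  have h2 := h n (by omega)
  rw [div_lt_iff₀ (by linarith)] at hM
  have : (M:ℝ) ≤ n := by exact_mod_cast (by omega)
  have : (M:ℝ) * (r - q) ≤ n * (r-q) := by
    apply mul_le_mul_of_nonneg_right this; linarith
  push_cast
  nlinarith

lemma PB_shift2 (u v : ℕ → ℝ) (C a : ℝ) (h : ∀ n, 1 ≤ n → v n ≤ u (n+1) + C) (hu : PB u a) :
    PB v a := by
  obtain ⟨q, hq, hf⟩ := hu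
  obtain ⟨r, hr1, hr2⟩ := exists_rat_btwn hq
  refine ⟨r, hr2, ?_⟩
  rw [frequently_atTop] at hf ⊢
  intro N
  obtain ⟨M, hM⟩ := exists_nat_gt ((C + q) / (r - q))
  obtain ⟨n, hn, hlt⟩ := hf (N + M + 2)
  obtain ⟨n, rfl⟩ : ∃ m, n = m + 1 := ⟨n-1, by omega⟩
  refine ⟨n, by omega, ?_⟩
  have h2 := h n (by omega)
  rw [div_lt_iff₀ (by linarith)] at hM
  have : (M:ℝ) ≤ n := by exact_mod_cast (by omega)
  have : (M:ℝ) * (r - q) ≤ n * (r-q) := by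
    apply mul_le_mul_of_nonneg_right this; linarith
  push_cast at hlt
  nlinarith

lemma PB_iff (u v : ℕ → ℝ) (C a : ℝ) (h : ∀ n, 1 ≤ n → |u (n+1) - v n| ≤ C) :
    PB u a ↔ PB v a :=
  ⟨PB_shift2 u v C a fun n hn => by have := (abs_le.mp (h n hn)).1; linarith,
   PB_shift1 u v C a fun n hn => by have := (abs_le.mp (h n hn)).2; linarith⟩

lemma PB_neg_iff (u v : ℕ → ℝ) (C a : ℝ) (h : ∀ n, 1 ≤ n → |u (n+1) - v n| ≤ C) :
    PB (fun n => - u n) a ↔ PB (fun n => - v n) a :=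
  PB_iff _ _ C a fun n hn => by
    have := h n hn
    rw [show - u (n+1) - - v n = -(u (n+1) - v n) by ring, abs_neg]; exact this

lemma PB_meas (f : ℕ → Ω → ℝ) (hf : ∀ n, Measurable (f n)) (a : ℝ) :
    MeasurableSet {x | PB (fun n => f n x) a} := by
  have : {x | PB (fun n => f n x) a} = ⋃ q : ℚ, ⋃ (_ : (q:ℝ) < a), ⋂ N : ℕ, ⋃ n, ⋃ (_ : N ≤ n),
      {x | f n x < n * q} := by
    ext x; simp [PB, frequently_atTop]
  rw [this]
  refine MeasurableSet.iUnion fun q => MeasurableSet.iUnion fun _ => MeasurableSet.iInter fun N =>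
    MeasurableSet.iUnion fun n => MeasurableSet.iUnion fun _ =>
      measurableSet_lt (hf n) measurable_const

lemma PB_exists {u : ℕ → ℝ} {a : ℝ} (h : PB u a) : ∃ n, 1 ≤ n ∧ u n ≤ n * a := by
  obtain ⟨q, hq, hf⟩ := h
  obtain ⟨n, hn, h⟩ := (frequently_atTop.mp hf) 1
  refine ⟨n, hn, h.le.trans ?_⟩
  gcongr

lemma conv_of_PB (u : ℕ → ℝ) (h : ∀ a b : ℚ, a < b → ¬ (PB u a ∧ PB (fun n => - u n) (-b)))
    (M : ℝ) (hM : ∀ᶠ n : ℕ in atTop, |u n| ≤ n * M) :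
    ∃ l, Tendsto (fun n : ℕ => u n / n) atTop (𝓝 l) := by
  have hM' : ∀ᶠ n : ℕ in atTop, |u n / n| ≤ M := by
    filter_upwards [hM, eventually_gt_atTop 0] with n hn h0
    have : (0:ℝ) < n := by exact_mod_cast h0
    rw [abs_div, abs_of_pos this, div_le_iff₀ this]; linarith
  refine tendsto_of_no_upcrossings (s := Set.range ((↑) : ℚ → ℝ)) Rat.denseRange_cast ?_ ?_ ?_
  · rintro _ ⟨a, rfl⟩ _ ⟨b, rfl⟩ hab ⟨h1, h2⟩
    have hab' : a < b := by exact_mod_cast hab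
    obtain ⟨a', ha1, ha2⟩ := exists_between hab'
    obtain ⟨b', hb1, hb2⟩ := exists_between ha2
    refine h a' b' hb1 ⟨⟨a, by exact_mod_cast ha1, ?_⟩, ⟨-b, by push_cast; simpa using hb2, ?_⟩⟩
    · refine (h1.and_eventually (eventually_gt_atTop 0)).mono ?_
      rintro n ⟨h, h0⟩
      have : (0:ℝ) < n := by exact_mod_cast h0
      rw [div_lt_iff₀ this] at h; linarith
    · refine (h2.and_eventually (eventually_gt_atTop 0)).mono ?_
      rintro n ⟨h, h0⟩
      have : (0:ℝ) < n := by exact_mod_cast h0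
      rw [lt_div_iff₀ this] at h; push_cast; linarith
  · exact ⟨M, by simpa using hM'.mono fun n hn => (abs_le.mp hn).2⟩
  · exact ⟨-M, by simpa using hM'.mono fun n hn => (abs_le.mp hn).1⟩

lemma restrict_mp {μ : Measure Ω} {T : Ω → Ω} (hT : MeasurePreserving T μ μ) {E : Set Ω}
    (hE : MeasurableSet E) (hinv : T ⁻¹' E = E) :
    MeasurePreserving T (μ.restrict E) (μ.restrict E) := by
  have := hT.restrict_preimage hE
  rwa [hinv] at this

lemma sum_shift (T : Ω → Ω) (h : Ω → ℝ) (x : Ω) (n : ℕ) :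
    |∑ k ∈ Finset.range (n+1), h (T^[k] x) - ∑ k ∈ Finset.range n, h (T^[k] (T x))| ≤ |h x| := by
  rw [Finset.sum_range_succ']
  simp [Function.iterate_succ_apply]

lemma meas_sum {μ : Measure Ω} {T : Ω → Ω} (hT : MeasurePreserving T μ μ)
    {g : Ω → ℝ} (hgm : Measurable g) (n : ℕ) :
    Measurable (fun x => ∑ k ∈ Finset.range n, g (T^[k] x)) :=
  Finset.measurable_sum _ fun k _ => hgm.comp (hT.iterate k).measurable

lemma sum_bdd (μ : Measure Ω) [IsFiniteMeasure μ] (T : Ω → Ω) (hT : MeasurePreserving T μ μ)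
    (g : Ω → ℝ) (hgm : Measurable g) (hgi : Integrable g μ) :
    ∀ᵐ x ∂μ, ∃ M : ℝ, ∀ᶠ n : ℕ in atTop, ∑ k ∈ Finset.range n, g (T^[k] x) ≤ n * M := by
  let E : Set Ω := {x | ∀ b : ℕ, PB (fun n => -∑ k ∈ Finset.range n, g (T^[k] x)) (-b)}
  have hE : MeasurableSet E := by
    have : E = ⋂ b : ℕ, {x | PB (fun n => -∑ k ∈ Finset.range n, g (T^[k] x)) (-b)} := by
      ext x; simp [E]
    rw [this]
    exact MeasurableSet.iInter fun b => PB_meas (fun n x => -∑ k ∈ Finset.range n, g (T^[k] x))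
      (fun n => (meas_sum hT hgm n).neg) _
  have hinv : T ⁻¹' E = E := by
    ext x
    simp only [E, Set.mem_preimage, Set.mem_ofPred_eq]
    refine forall_congr' fun b => (PB_neg_iff _ _ |g x| _ fun n _ => sum_shift T g x n).symm
  have hb : ∀ b : ℕ, b * μ.real E ≤ ∫ x in E, g x ∂μ := by
    intro b
    have := lemma2 (μ.restrict E) T (restrict_mp hT hE hinv) (fun x => - g x) hgm.neg
      hgi.integrableOn.neg (-b) (by
        filter_upwards [ae_restrict_mem hE] with x hx
        simpa using PB_exists (hx b))
    rw [integral_neg] at this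
    simp only [measureReal_restrict_apply_univ] at this
    linarith
  have h0 : μ.real E = 0 := by
    by_contra hne
    have hpos : 0 < μ.real E := lt_of_le_of_ne measureReal_nonneg (Ne.symm hne)
    obtain ⟨b, hb'⟩ := exists_nat_gt ((∫ x in E, g x ∂μ) / μ.real E)
    rw [div_lt_iff₀ hpos] at hb'
    linarith [hb b]
  have h0' : μ E = 0 := by
    rwa [measureReal_eq_zero_iff] at h0
  filter_upwards [measure_eq_zero_iff_ae_notMem.mp h0'] with x hx
  simp only [E, Set.mem_ofPred_eq, not_forall] at hx
  obtain ⟨b, hb⟩ := hx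
  refine ⟨b + 1, ?_⟩
  simp only [PB, not_exists, not_and, not_frequently, not_lt] at hb
  have := hb (-(b+1)) (by push_cast; linarith)
  filter_upwards [this] with n hn
  push_cast at hn
  linarith

/-- core: no crossing on invariant sets implies convergence -/
lemma conv_core (μ : Measure Ω) [IsFiniteMeasure μ] (T : Ω → Ω) (hT : MeasurePreserving T μ μ)
    (f : ℕ → Ω → ℝ) (g : Ω → ℝ) (hgm : Measurable g) (hgi : Integrable g μ)
    (hfm : ∀ n, Measurable (f n))
    (hdom : ∀ n, 1 ≤ n → ∀ x, |f n x| ≤ ∑ k ∈ Finset.range n, g (T^[k] x))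
    (hsh : ∀ x n, 1 ≤ n → |f (n+1) x - f n (T x)| ≤ g x)
    (hcross : ∀ (a b : ℝ) (E : Set Ω), MeasurableSet E → T ⁻¹' E = E → a < b →
      (∀ x ∈ E, PB (fun n => f n x) a) → (∀ x ∈ E, PB (fun n => - f n x) (-b)) → μ.real E = 0) :
    ∀ᵐ x ∂μ, ∃ l, Tendsto (fun n : ℕ => f n x / n) atTop (𝓝 l) := by
  have hno : ∀ᵐ x ∂μ, ∀ a b : ℚ, a < b →
      ¬ (PB (fun n => f n x) a ∧ PB (fun n => - f n x) (-b)) := by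
    rw [ae_all_iff]; intro a
    rw [ae_all_iff]; intro b
    by_cases hab : a < b
    swap
    · exact ae_of_all _ fun x h => absurd h hab
    let E : Set Ω := {x | PB (fun n => f n x) a} ∩ {x | PB (fun n => - f n x) (-b)}
    have hE : MeasurableSet E := (PB_meas f hfm _).inter
      (PB_meas (fun n x => - f n x) (fun n => (hfm n).neg) _)
    have hinv : T ⁻¹' E = E := by
      ext x
      simp only [E, Set.mem_preimage, Set.mem_inter_iff, Set.mem_ofPred_eq]
      exact (and_congr (PB_iff _ _ (g x) _ (hsh x)) (PB_neg_iff _ _ (g x) _ (hsh x))).symm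
    have h0 := hcross a b E hE hinv (by exact_mod_cast hab) (fun x hx => hx.1) (fun x hx => hx.2)
    rw [measureReal_eq_zero_iff] at h0
    filter_upwards [measure_eq_zero_iff_ae_notMem.mp h0] with x hx _ hc
    exact hx hc
  filter_upwards [hno, sum_bdd μ T hT g hgm hgi] with x hx ⟨M, hM⟩
  refine conv_of_PB _ hx M ?_
  filter_upwards [hM, eventually_ge_atTop 1] with n hn h1
  exact (hdom n h1 x).trans hn

lemma birkhoff (μ : Measure Ω) [IsFiniteMeasure μ] (T : Ω → Ω) (hT : MeasurePreserving T μ μ)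
    (g : Ω → ℝ) (hgm : Measurable g) (hgi : Integrable g μ) :
    ∀ᵐ x ∂μ, ∃ l, Tendsto (fun n : ℕ => (∑ k ∈ Finset.range n, g (T^[k] x)) / n) atTop (𝓝 l) := by
  refine conv_core μ T hT (fun n x => ∑ k ∈ Finset.range n, g (T^[k] x)) (fun x => |g x|)
    (by simpa using hgm.norm) hgi.abs (meas_sum hT hgm) (fun n _ x => Finset.abs_sum_le_sum_abs _ _)
    (fun x n _ => sum_shift T g x n) ?_
  intro a b E hE hinv hab ha hb
  have h1 := lemma2 (μ.restrict E) T (restrict_mp hT hE hinv) g hgm hgi.integrableOn a (by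
        filter_upwards [ae_restrict_mem hE] with x hx
        exact PB_exists (ha x hx))
  have h2 := lemma2 (μ.restrict E) T (restrict_mp hT hE hinv) (fun x => - g x) hgm.neg
      hgi.integrableOn.neg (-b) (by
        filter_upwards [ae_restrict_mem hE] with x hx
        simpa using PB_exists (hb x hx))
  rw [integral_neg] at h2
  simp only [measureReal_restrict_apply_univ] at h1 h2
  have : 0 ≤ μ.real E := measureReal_nonneg
  nlinarith

lemma iter_div (μ : Measure Ω) [IsFiniteMeasure μ] (T : Ω → Ω) (hT : MeasurePreserving T μ μ)
    (g : Ω → ℝ) (hgm : Measurable g) (hgi : Integrable g μ) :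
    ∀ᵐ x ∂μ, Tendsto (fun n : ℕ => g (T^[n] x) / n) atTop (𝓝 0) := by
  filter_upwards [birkhoff μ T hT g hgm hgi] with x ⟨l, hl⟩
  have h1 : Tendsto (fun n : ℕ => (∑ k ∈ Finset.range (n+1), g (T^[k] x)) / ((n+1:ℕ):ℝ))
      atTop (𝓝 l) := hl.comp (tendsto_add_atTop_nat 1)
  have h2 : Tendsto (fun n : ℕ => ((n+1:ℕ):ℝ) / n) atTop (𝓝 1) := by
    have : Tendsto (fun n : ℕ => 1 + 1 / (n:ℝ)) atTop (𝓝 (1 + 0)) :=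
      tendsto_const_nhds.add tendsto_one_div_atTop_nhds_zero_nat
    rw [add_zero] at this
    refine this.congr' ?_
    filter_upwards [eventually_gt_atTop 0] with n hn
    have : (n:ℝ) ≠ 0 := by exact_mod_cast hn.ne'
    push_cast; field_simp
  have h3 := (h1.mul h2).sub hl
  rw [mul_one, sub_self] at h3
  refine h3.congr' ?_
  filter_upwards [eventually_gt_atTop 0] with n hn
  have : (n:ℝ) ≠ 0 := by exact_mod_cast hn.ne'
  have : ((n+1:ℕ):ℝ) ≠ 0 := by positivity
  rw [Finset.sum_range_succ]
  field_simp
  ring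

lemma le_block (T : Ω → Ω) (f : ℕ → Ω → ℝ) (g : Ω → ℝ)
    (hsub : ∀ m n x, 1 ≤ m → 1 ≤ n → f (m + n) x ≤ f m x + f n (T^[m] x))
    (h1 : ∀ x, f 1 x ≤ g x) (N : ℕ) (hN : 1 ≤ N) :
    ∀ m x, 1 ≤ m → f (N * m) x ≤ ∑ j ∈ Finset.range m, f N ((T^[N])^[j] x) := by
  intro m x hm
  have := le_sum (T^[N]) (fun m x => f (N * m) x) (f N) (by
    intro m n x hm hn
    rw [mul_add, ← Function.iterate_mul]
    exact hsub _ _ x (Nat.mul_pos hN hm) (Nat.mul_pos hN hn)) (fun x => by simp) m hm x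
  exact this

lemma le_block' (T : Ω → Ω) (f : ℕ → Ω → ℝ) (g : Ω → ℝ)
    (hsub : ∀ m n x, 1 ≤ m → 1 ≤ n → f (m + n) x ≤ f m x + f n (T^[m] x))
    (h1 : ∀ x, f 1 x ≤ g x) (N : ℕ) (hN : 1 ≤ N) (m r : ℕ) (hm : 1 ≤ m) (x : Ω) :
    f (N * m + r) x ≤ ∑ j ∈ Finset.range m, f N ((T^[N])^[j] x)
      + ∑ k ∈ Finset.range r, g (T^[N * m + k] x) := by
  have hb := le_block T f g hsub h1 N hN m x hm
  rcases Nat.eq_zero_or_pos r with rfl | hr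
  · simpa using hb
  · have h2 := hsub (N*m) r x (Nat.mul_pos hN hm) hr
    have h3 := le_sum T f g hsub h1 r hr (T^[N*m] x)
    have h4 : ∑ k ∈ Finset.range r, g (T^[k] (T^[N*m] x)) =
        ∑ k ∈ Finset.range r, g (T^[N * m + k] x) := by
      refine Finset.sum_congr rfl fun k _ => ?_
      rw [← Function.iterate_add_apply, add_comm]
    linarith

lemma block_exists (T : Ω → Ω) (f : ℕ → Ω → ℝ) (g : Ω → ℝ)
    (hsub : ∀ m n x, 1 ≤ m → 1 ≤ n → f (m + n) x ≤ f m x + f n (T^[m] x))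
    (h1 : ∀ x, f 1 x ≤ g x) (N : ℕ) (hN : 1 ≤ N) (x : Ω) (b : ℝ)
    (hb : PB (fun n => - f n x) (-b)) (hg0 : Tendsto (fun n : ℕ => g (T^[n] x) / n) atTop (𝓝 0)) :
    ∃ m, 1 ≤ m ∧ m * (N * b) ≤ ∑ j ∈ Finset.range m, f N ((T^[N])^[j] x) := by
  obtain ⟨q, hq, hf⟩ := hb
  set δ : ℝ := -q - b with hδ
  have hδ0 : 0 < δ := by simp only [hδ]; linarith
  have hN0 : (0:ℝ) < N := by exact_mod_cast hN
  have hev := hg0.eventually (gt_mem_nhds (show 0 < δ / (2 * N) by positivity))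
  obtain ⟨K, hK⟩ := eventually_atTop.mp hev
  obtain ⟨M, hM⟩ := exists_nat_gt (N * |b| / (δ/2))
  obtain ⟨n, hn, hlt⟩ := frequently_atTop.mp hf (K + M + 1 + N)
  set m := n / N with hmdef
  set r := n % N with hrdef
  have hnr : N * m + r = n := Nat.div_add_mod n N
  have hrN : r < N := Nat.mod_lt _ hN
  have hm : 1 ≤ m := Nat.div_pos (by omega) hN
  refine ⟨m, hm, ?_⟩
  have h2 := le_block' T f g hsub h1 N hN m r hm x
  rw [hnr] at h2
  have hn0 : (0:ℝ) < n := by exact_mod_cast (by omega)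
  have h3 : ∑ k ∈ Finset.range r, g (T^[N * m + k] x) ≤ n * (δ / 2) := by
    have : ∀ k ∈ Finset.range r, g (T^[N * m + k] x) ≤ n * (δ / (2*N)) := by
      intro k hk
      have hk' : k < r := Finset.mem_range.mp hk
      have hge : K ≤ N * m + k := by omega
      have h := hK _ hge
      have hp : (0:ℝ) < ((N * m + k : ℕ):ℝ) := by exact_mod_cast (by omega)
      rw [div_lt_iff₀ hp] at h
      refine h.le.trans ?_
      rw [mul_comm]
      gcongr
      omega
    refine (Finset.sum_le_sum this).trans ?_
    rw [Finset.sum_const, Finset.card_range, nsmul_eq_mul]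
    have hrN' : (r:ℝ) ≤ N := by exact_mod_cast hrN.le
    calc (r:ℝ) * (n * (δ / (2*N))) ≤ N * (n * (δ / (2*N))) := by gcongr
      _ = n * (δ/2) := by field_simp
  have h4 : N * |b| ≤ n * (δ/2) := by
    rw [div_lt_iff₀ (by positivity)] at hM
    refine hM.le.trans ?_
    gcongr
    omega
  have hnR : (n:ℝ) = N * m + r := by exact_mod_cast hnr.symm
  have h5 : (m:ℝ) * (N * b) ≤ n * b + N * |b| := by
    have : -(r * b) ≤ N * |b| := by
      have h : -(r*b) ≤ r * |b| := by
        have := neg_abs_le b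
        have : (0:ℝ) ≤ r := Nat.cast_nonneg _
        nlinarith
      refine h.trans ?_
      gcongr
    rw [hnR]; linarith
  have h6 : (n:ℝ) * q = - n * δ - n * b := by rw [hδ]; ring
  linarith

theorem kingman (μ : Measure Ω) [IsFiniteMeasure μ] (T : Ω → Ω) (hT : MeasurePreserving T μ μ)
    (f : ℕ → Ω → ℝ) (g : Ω → ℝ) (hgm : Measurable g) (hgi : Integrable g μ) (hg : ∀ x, 0 ≤ g x)
    (hfm : ∀ n, Measurable (f n))
    (hsub : ∀ m n x, 1 ≤ m → 1 ≤ n → f (m + n) x ≤ f m x + f n (T^[m] x))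
    (hdom : ∀ n, 1 ≤ n → ∀ x, |f n x| ≤ ∑ k ∈ Finset.range n, g (T^[k] x))
    (hsh : ∀ x n, 1 ≤ n → |f (n+1) x - f n (T x)| ≤ g x) :
    ∀ᵐ x ∂μ, ∃ l, Tendsto (fun n : ℕ => f n x / n) atTop (𝓝 l) := by
  refine conv_core μ T hT f g hgm hgi hfm hdom hsh ?_
  have h1 : ∀ x, f 1 x ≤ g x := fun x => by
    have := hdom 1 le_rfl x
    simp at this
    exact (le_abs_self _).trans this
  intro a b E hE hinv hab ha hb
  have hTE := restrict_mp hT hE hinv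
  have hfi : ∀ n, 1 ≤ n → Integrable (f n) (μ.restrict E) := by
    intro n hn
    refine Integrable.mono' (g := fun x => ∑ k ∈ Finset.range n, g (T^[k] x))
      (integrable_finsetSum _ fun k _ => mp_integrable (hTE.iterate k) hgi.integrableOn)
      (hfm n).aestronglyMeasurable (ae_of_all _ fun x => by simpa using hdom n hn x)
  by_contra hne
  have hpos : 0 < μ.real E := lt_of_le_of_ne measureReal_nonneg (Ne.symm hne)
  obtain ⟨N, hN1, hN⟩ := lemma1' (μ.restrict E) T hTE f g hg hgi.integrableOn hfm hfi hsub h1 a (by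
        filter_upwards [ae_restrict_mem hE] with x hx
        exact PB_exists (ha x hx)) ((b - a) * μ.real E / 2) (by nlinarith)
  have hu := hN N le_rfl
  have h2 := lemma2 (μ.restrict E) (T^[N]) (hTE.iterate N) (fun x => - f N x) (hfm N).neg
      (hfi N hN1).neg (-(N * b)) (by
        filter_upwards [ae_restrict_mem hE, iter_div (μ.restrict E) T hTE g hgm hgi.integrableOn]
          with x hx hx0
        obtain ⟨m, hm, h⟩ := block_exists T f g hsub h1 N hN1 x b (hb x hx) hx0
        refine ⟨m, hm, ?_⟩
        rw [Finset.sum_neg_distrib]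
        linarith)
  rw [integral_neg] at h2
  simp only [measureReal_restrict_apply_univ] at hu h2
  have hN0 : (0:ℝ) < N := by exact_mod_cast hN1
  have h3 : (N:ℝ) * (b * μ.real E) ≤ N * (a * μ.real E + (b - a) * μ.real E / 2) := by linarith
  have := le_of_mul_le_mul_left h3 hN0
  nlinarith

end Kingman
end MET

namespace MET

section Minors

variable {d : ℕ}

/-- sum of absolute values of `k × k` minors -/
def mnr (k : ℕ) (M : Matrix (Fin d) (Fin d) ℝ) : ℝ :=
  ∑ f : Fin k → Fin d, ∑ g : Fin k → Fin d, |(M.submatrix f g).det|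

lemma det_sub_mul (k : ℕ) (M N : Matrix (Fin d) (Fin d) ℝ) (f g : Fin k → Fin d) :
    ((M * N).submatrix f g).det =
      ∑ h : Fin k → Fin d, (M.submatrix f h).det * ∏ i, N (h i) (g i) := by
  simp only [det_apply', Matrix.mul_apply, Finset.prod_univ_sum, Finset.mul_sum,
    Fintype.piFinset_univ, submatrix_apply, Finset.sum_mul]
  rw [Finset.sum_comm]
  refine Finset.sum_congr rfl fun h _ => Finset.sum_congr rfl fun σ _ => ?_
  rw [Finset.prod_mul_distrib]; ring

lemma cauchy_binet (k : ℕ) (M N : Matrix (Fin d) (Fin d) ℝ) (f g : Fin k → Fin d) :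
    (k.factorial : ℝ) * ((M * N).submatrix f g).det =
      ∑ h : Fin k → Fin d, (M.submatrix f h).det * (N.submatrix h g).det := by
  have key : ∀ σ : Equiv.Perm (Fin k), ((M * N).submatrix f g).det =
      ∑ h : Fin k → Fin d, (M.submatrix f h).det *
        (((Equiv.Perm.sign σ : ℤ) : ℝ) * ∏ i, N (h (σ i)) (g i)) := by
    intro σ
    rw [det_sub_mul, ← Equiv.sum_comp (Equiv.arrowCongr σ.symm (Equiv.refl (Fin d)))]
    refine Finset.sum_congr rfl fun h _ => ?_
    have e : M.submatrix f ((Equiv.arrowCongr σ.symm (Equiv.refl (Fin d))) h) =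
        (M.submatrix f h).submatrix id σ := by
      ext i j; simp [Equiv.arrowCongr]
    rw [e, det_permute']
    simp [Equiv.arrowCongr]
    ring
  have h1 : ∑ σ : Equiv.Perm (Fin k), ((M * N).submatrix f g).det =
      (k.factorial : ℝ) * ((M * N).submatrix f g).det := by
    simp [Fintype.card_perm]
  rw [← h1, Finset.sum_congr rfl fun σ _ => key σ, Finset.sum_comm]
  refine Finset.sum_congr rfl fun h _ => ?_
  rw [← Finset.mul_sum, det_apply' (N.submatrix h g)]
  simp

lemma mnr_mul (k : ℕ) (M N : Matrix (Fin d) (Fin d) ℝ) : mnr k (M * N) ≤ mnr k M * mnr k N := by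
  have h1 : ∀ f g : Fin k → Fin d, |((M * N).submatrix f g).det| ≤
      ∑ h : Fin k → Fin d, |(M.submatrix f h).det| * |(N.submatrix h g).det| := by
    intro f g
    have hk : (1:ℝ) ≤ k.factorial := by exact_mod_cast Nat.factorial_pos k
    calc |((M * N).submatrix f g).det| ≤ k.factorial * |((M * N).submatrix f g).det| :=
          le_mul_of_one_le_left (abs_nonneg _) hk
      _ = |(k.factorial:ℝ) * ((M * N).submatrix f g).det| := by
          rw [abs_mul, abs_of_nonneg (by linarith : (0:ℝ) ≤ k.factorial)]
      _ ≤ _ := by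
          rw [cauchy_binet]
          refine (Finset.abs_sum_le_sum_abs _ _).trans (le_of_eq ?_)
          simp [abs_mul]
  have h2 : ∀ h : Fin k → Fin d, ∀ f : Fin k → Fin d,
      |(M.submatrix f h).det| * ∑ g : Fin k → Fin d, |(N.submatrix h g).det| ≤
      |(M.submatrix f h).det| * mnr k N := by
    intro h f
    refine mul_le_mul_of_nonneg_left ?_ (abs_nonneg _)
    exact Finset.single_le_sum (f := fun h : Fin k → Fin d =>
      ∑ g : Fin k → Fin d, |(N.submatrix h g).det|)
      (fun _ _ => Finset.sum_nonneg fun _ _ => abs_nonneg _) (Finset.mem_univ h)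
  calc mnr k (M * N) ≤ ∑ f : Fin k → Fin d, ∑ g : Fin k → Fin d,
        ∑ h : Fin k → Fin d, |(M.submatrix f h).det| * |(N.submatrix h g).det| :=
        Finset.sum_le_sum fun f _ => Finset.sum_le_sum fun g _ => h1 f g
    _ = ∑ f : Fin k → Fin d, ∑ h : Fin k → Fin d,
        |(M.submatrix f h).det| * ∑ g : Fin k → Fin d, |(N.submatrix h g).det| := by
        refine Finset.sum_congr rfl fun f _ => ?_
        rw [Finset.sum_comm]
        simp only [Finset.mul_sum]
    _ ≤ ∑ f : Fin k → Fin d, ∑ h : Fin k → Fin d, |(M.submatrix f h).det| * mnr k N :=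
        Finset.sum_le_sum fun f _ => Finset.sum_le_sum fun h _ => h2 h f
    _ = mnr k M * mnr k N := by
        simp only [← Finset.sum_mul]; rfl

lemma mnr_nonneg (k : ℕ) (M : Matrix (Fin d) (Fin d) ℝ) : 0 ≤ mnr k M :=
  Finset.sum_nonneg fun _ _ => Finset.sum_nonneg fun _ _ => abs_nonneg _

lemma le_mnr (k : ℕ) (M : Matrix (Fin d) (Fin d) ℝ) (f g : Fin k → Fin d) :
    |(M.submatrix f g).det| ≤ mnr k M := by
  refine le_trans ?_ (Finset.single_le_sum (f := fun f : Fin k → Fin d =>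
      ∑ g : Fin k → Fin d, |(M.submatrix f g).det|)
      (fun _ _ => Finset.sum_nonneg fun _ _ => abs_nonneg _) (Finset.mem_univ f))
  exact Finset.single_le_sum (f := fun g : Fin k → Fin d => |(M.submatrix f g).det|)
      (fun _ _ => abs_nonneg _) (Finset.mem_univ g)

/-- constant -/
def Cb (d k : ℕ) : ℝ := (d:ℝ)^k * ((d:ℝ)^k * k.factorial)

lemma mnr_le_of (k : ℕ) (M : Matrix (Fin d) (Fin d) ℝ) (y : ℝ)
    (h : ∀ f g : Fin k → Fin d, |(M.submatrix f g).det| ≤ k.factorial * y) :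
    mnr k M ≤ Cb d k * y := by
  calc mnr k M ≤ ∑ f : Fin k → Fin d, ∑ g : Fin k → Fin d, k.factorial * y :=
        Finset.sum_le_sum fun f _ => Finset.sum_le_sum fun g _ => h f g
    _ = _ := by simp [Cb]; ring

lemma mnr_le (k : ℕ) (M : Matrix (Fin d) (Fin d) ℝ) (x : ℝ) (h : ∀ i j, |M i j| ≤ x) :
    mnr k M ≤ Cb d k * x ^ k := by
  refine mnr_le_of k M _ fun f g => ?_
  have := Matrix.det_le (A := M.submatrix f g) (abv := AbsoluteValue.abs) (x := x)
    (fun i j => h _ _)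
  simpa [nsmul_eq_mul] using this

lemma orth_entry (U : Matrix (Fin d) (Fin d) ℝ) (hU : Uᵀ * U = 1) (i j : Fin d) : |U i j| ≤ 1 := by
  have h : (Uᵀ * U) j j = 1 := by rw [hU]; simp
  rw [Matrix.mul_apply] at h
  have h2 : U i j * U i j ≤ ∑ a, Uᵀ j a * U a j := by
    refine Finset.single_le_sum (f := fun a => Uᵀ j a * U a j) (fun a _ => ?_) (Finset.mem_univ i)
    simp only [transpose_apply]; exact mul_self_nonneg _
  rw [h] at h2
  rw [abs_le_one_iff_mul_self_le_one]; exact h2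

lemma mnr_orth (k : ℕ) (U : Matrix (Fin d) (Fin d) ℝ) (hU : Uᵀ * U = 1) : mnr k U ≤ Cb d k := by
  simpa using mnr_le k U 1 (orth_entry U hU)

lemma prod_inj_le (s : Fin d → ℝ) (hs : Antitone s) (hpos : ∀ i, 0 < s i) (k : ℕ) (hk : k ≤ d)
    (g : Fin k → Fin d) (hg : Function.Injective g) :
    ∏ i, s (g i) ≤ ∏ i : Fin k, s (Fin.castLE hk i) := by
  classical
  set S : Finset (Fin d) := Finset.univ.image g with hS
  have hc : S.card = k := by rw [hS, Finset.card_image_of_injective _ hg]; simp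
  have e1 : ∏ i, s (g i) = ∏ a ∈ S, s a := by
    rw [hS, Finset.prod_image (fun a _ b _ h => hg h)]
  have e2 : ∏ a ∈ S, s a = ∏ i : Fin k, s (S.orderEmbOfFin hc i) := by
    rw [← Finset.prod_coe_sort S, ← Equiv.prod_comp (S.orderIsoOfFin hc).toEquiv]
    rfl
  rw [e1, e2]
  refine Finset.prod_le_prod (fun i _ => (hpos _).le) fun i _ => hs ?_
  have hmono : StrictMono (S.orderEmbOfFin hc) := (S.orderEmbOfFin hc).strictMono
  rw [Fin.le_def]
  have : ∀ n (hn : n < k), n ≤ (S.orderEmbOfFin hc ⟨n, hn⟩ : ℕ) := by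
    intro n
    induction n with
    | zero => intro _; omega
    | succ n ih =>
      intro hn
      have h1 := ih (by omega)
      have h2 : (S.orderEmbOfFin hc ⟨n, by omega⟩ : ℕ) < (S.orderEmbOfFin hc ⟨n+1, hn⟩ : ℕ) :=
        Fin.lt_def.mp (hmono (by rw [Fin.lt_def]; simp))
      omega
  simpa using this i i.2

lemma mnr_diag_le (s : Fin d → ℝ) (hs : Antitone s) (hpos : ∀ i, 0 < s i) (k : ℕ) (hk : k ≤ d) :
    mnr k (diagonal s) ≤ Cb d k * ∏ i : Fin k, s (Fin.castLE hk i) := by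
  refine mnr_le_of k _ _ fun f g => ?_
  have hP : 0 ≤ ∏ i : Fin k, s (Fin.castLE hk i) := Finset.prod_nonneg fun i _ => (hpos _).le
  by_cases hg : Function.Injective g
  · rw [det_apply']
    refine (Finset.abs_sum_le_sum_abs _ _).trans ?_
    have : ∀ σ ∈ (Finset.univ : Finset (Equiv.Perm (Fin k))),
        |((Equiv.Perm.sign σ : ℤ) : ℝ) * ∏ i, (diagonal s).submatrix f g (σ i) i| ≤
        ∏ i : Fin k, s (Fin.castLE hk i) := by
      intro σ _
      rw [abs_mul]
      have h1 : |((Equiv.Perm.sign σ : ℤ) : ℝ)| = 1 := by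
        rcases Int.units_eq_one_or (Equiv.Perm.sign σ) with h | h <;> simp [h]
      rw [h1, one_mul, Finset.abs_prod]
      refine le_trans ?_ (prod_inj_le s hs hpos k hk g hg)
      refine Finset.prod_le_prod (fun i _ => abs_nonneg _) fun i _ => ?_
      simp only [submatrix_apply, diagonal_apply]
      split_ifs with h
      · rw [h, abs_of_pos (hpos _)]
      · simpa using (hpos _).le
    refine (Finset.sum_le_sum this).trans ?_
    simp [Fintype.card_perm]
  · rw [Function.Injective] at hg
    push Not at hg
    obtain ⟨a, b, hab, hne⟩ := hg
    rw [det_zero_of_column_eq hne (fun i => by simp [hab])]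
    simp only [abs_zero]
    positivity

lemma le_mnr_diag (s : Fin d → ℝ) (hpos : ∀ i, 0 < s i) (k : ℕ) (hk : k ≤ d) :
    ∏ i : Fin k, s (Fin.castLE hk i) ≤ mnr k (diagonal s) := by
  refine le_trans (le_of_eq ?_) (le_mnr k (diagonal s) (Fin.castLE hk) (Fin.castLE hk))
  have : (diagonal s).submatrix (Fin.castLE hk) (Fin.castLE hk) =
      diagonal (fun i => s (Fin.castLE hk i)) := by
    ext i j; simp [diagonal_apply, Fin.ext_iff]
  rw [this, det_diagonal, abs_of_nonneg (Finset.prod_nonneg fun i _ => (hpos _).le)]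

lemma one_le_mnr_one (k : ℕ) (hk : k ≤ d) : 1 ≤ mnr k (1 : Matrix (Fin d) (Fin d) ℝ) := by
  have := le_mnr_diag (fun _ : Fin d => (1:ℝ)) (fun _ => one_pos) k hk
  simpa using this

lemma svd_exists (T : Matrix (Fin d) (Fin d) ℝ) (hT : IsUnit T.det) :
    ∃ (U : Matrix (Fin d) (Fin d) ℝ) (s : Fin d → ℝ), Uᵀ * U = 1 ∧ (∀ i, 0 < s i) ∧ Antitone s ∧
      Tᵀ * T = U * diagonal (fun i => s i ^ 2) * Uᵀ := by
  have hpd : (Tᵀ * T).PosDef := by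
    have := Matrix.PosDef.conjTranspose_mul_self T (by
      exact Matrix.mulVec_injective_iff_isUnit.mpr ((Matrix.isUnit_iff_isUnit_det T).mpr hT))
    simpa using this
  have hH := hpd.isHermitian
  set v := hH.eigenvalues with hv
  have hvpos : ∀ i, 0 < v i := hpd.eigenvalues_pos
  set W : Matrix (Fin d) (Fin d) ℝ := hH.eigenvectorUnitary.1 with hW
  have hWW : Wᵀ * W = 1 := by
    have := (Matrix.mem_unitaryGroup_iff').mp hH.eigenvectorUnitary.2
    simpa [star_eq_conjTranspose] using this
  have hsp : Tᵀ * T = W * diagonal v * Wᵀ := by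
    have := hH.spectral_theorem
    rw [Unitary.conjStarAlgAut_apply] at this
    simpa [star_eq_conjTranspose, Function.comp_def] using this
  set τ := Tuple.sort (fun i => - v i) with hτ
  have hmon := Tuple.monotone_sort (fun i => - v i)
  refine ⟨W.submatrix id τ, fun i => Real.sqrt (v (τ i)), ?_, fun i => Real.sqrt_pos.mpr (hvpos _),
    ?_, ?_⟩
  · have : (W.submatrix id τ)ᵀ * W.submatrix id τ = (Wᵀ * W).submatrix τ τ := by
      ext i j; simp [Matrix.mul_apply]
    rw [this, hWW]; simp
  · intro i j hij
    have := hmon hij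
    simp only [Function.comp_apply, neg_le_neg_iff] at this
    exact Real.sqrt_le_sqrt this
  · rw [hsp]
    ext i j
    rw [Matrix.mul_apply, Matrix.mul_apply]
    simp only [mul_diagonal, transpose_apply, submatrix_apply, id]
    rw [← Equiv.sum_comp τ]
    refine Finset.sum_congr rfl fun a _ => ?_
    rw [Real.sq_sqrt (hvpos _).le]

lemma svd_mnr (T U : Matrix (Fin d) (Fin d) ℝ) (s : Fin d → ℝ) (hU : Uᵀ * U = 1)
    (hpos : ∀ i, 0 < s i) (hs : Antitone s)
    (h : Tᵀ * T = U * diagonal (fun i => s i ^ 2) * Uᵀ) (k : ℕ) (hk : k ≤ d) :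
    mnr k T ≤ Cb d k ^ 3 * ∏ i : Fin k, s (Fin.castLE hk i) ∧
    ∏ i : Fin k, s (Fin.castLE hk i) ≤ Cb d k ^ 2 * mnr k T := by
  have hUU : U * Uᵀ = 1 := mul_eq_one_comm.mp hU
  set W := T * U * diagonal (fun i => (s i)⁻¹) with hW
  have hdd : diagonal (fun i => (s i)⁻¹) * diagonal s = 1 := by
    rw [diagonal_mul_diagonal, ← diagonal_one]
    congr 1; ext i; exact inv_mul_cancel₀ (hpos i).ne'
  have hd3 : diagonal (fun i => (s i)⁻¹) * diagonal (fun i => s i ^ 2) *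
      diagonal (fun i => (s i)⁻¹) = 1 := by
    rw [diagonal_mul_diagonal, diagonal_mul_diagonal, ← diagonal_one]
    congr 1; ext i; have := (hpos i).ne'; field_simp
  have hWW : Wᵀ * W = 1 := by
    calc Wᵀ * W = diagonal (fun i => (s i)⁻¹) * (Uᵀ * (Tᵀ * T) * U) * diagonal (fun i => (s i)⁻¹) := by
          rw [hW]; simp only [transpose_mul, diagonal_transpose, Matrix.mul_assoc]
      _ = diagonal (fun i => (s i)⁻¹) * ((Uᵀ * U) * diagonal (fun i => s i ^ 2) * (Uᵀ * U))
            * diagonal (fun i => (s i)⁻¹) := by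
          rw [h]; simp only [Matrix.mul_assoc]
      _ = 1 := by rw [hU, Matrix.one_mul, Matrix.mul_one, hd3]
  have hT : T = W * diagonal s * Uᵀ := by
    rw [hW, Matrix.mul_assoc (T * U), hdd, Matrix.mul_one, Matrix.mul_assoc, hUU, Matrix.mul_one]
  have hD : diagonal s = Wᵀ * T * U := by
    calc diagonal s = (Wᵀ * W) * diagonal s * (Uᵀ * U) := by rw [hWW, hU]; simp
      _ = Wᵀ * (W * diagonal s * Uᵀ) * U := by simp only [Matrix.mul_assoc]
      _ = _ := by rw [← hT]
  have hWt : Wᵀᵀ * Wᵀ = 1 := by rw [transpose_transpose]; exact mul_eq_one_comm.mp hWW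
  have hUt : Uᵀᵀ * Uᵀ = 1 := by rw [transpose_transpose]; exact hUU
  have hC : 0 ≤ Cb d k := (mnr_nonneg k U).trans (mnr_orth k U hU)
  constructor
  · calc mnr k T = mnr k (W * diagonal s * Uᵀ) := by rw [← hT]
      _ ≤ mnr k W * mnr k (diagonal s) * mnr k Uᵀ :=
        (mnr_mul _ _ _).trans (mul_le_mul_of_nonneg_right (mnr_mul _ _ _) (mnr_nonneg _ _))
      _ ≤ Cb d k * (Cb d k * ∏ i : Fin k, s (Fin.castLE hk i)) * Cb d k := by
        have h1 := mnr_orth k W hWW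
        have h2 := mnr_orth k Uᵀ hUt
        have h3 := mnr_diag_le s hs hpos k hk
        have h0 := mnr_nonneg k (diagonal s)
        have h4 := mnr_nonneg k Uᵀ
        have h5 := mnr_nonneg k W
        gcongr
        exact mul_nonneg hC (h0.trans h3)
      _ = _ := by ring
  · refine (le_mnr_diag s hpos k hk).trans ?_
    calc mnr k (diagonal s) = mnr k (Wᵀ * T * U) := by rw [← hD]
      _ ≤ mnr k Wᵀ * mnr k T * mnr k U :=
        (mnr_mul _ _ _).trans (mul_le_mul_of_nonneg_right (mnr_mul _ _ _) (mnr_nonneg _ _))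
      _ ≤ Cb d k * mnr k T * Cb d k := by
        have h1 := mnr_orth k Wᵀ hWt
        have h2 := mnr_orth k U hU
        have h4 := mnr_nonneg k T
        have h5 := mnr_nonneg k U
        gcongr
      _ = _ := by ring

end Minors
end MET

namespace MET

section Rates

/-- exponential growth rate at most `r` -/
def RT (a : ℕ → ℝ) (r : ℝ) : Prop := ∀ ε > 0, ∀ᶠ n : ℕ in atTop, a n ≤ Real.exp (n * (r + ε))

lemma ev_exp (C ε : ℝ) (hε : 0 < ε) : ∀ᶠ n : ℕ in atTop, C ≤ Real.exp (n * ε) := by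
  have h : Tendsto (fun n : ℕ => Real.exp (n * ε)) atTop atTop :=
    Real.tendsto_exp_atTop.comp (tendsto_natCast_atTop_atTop.atTop_mul_const hε)
  exact h.eventually_ge_atTop C

lemma RT.of_le {a b : ℕ → ℝ} {r : ℝ} (hb : RT b r) (h : ∀ᶠ n in atTop, a n ≤ b n) : RT a r :=
  fun ε hε => by
    filter_upwards [hb ε hε, h] with n h1 h2
    exact h2.trans h1

lemma RT.mono {a : ℕ → ℝ} {r r' : ℝ} (ha : RT a r) (h : r ≤ r') : RT a r' :=
  fun ε hε => by
    filter_upwards [ha ε hε] with n h1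
    refine h1.trans ?_
    gcongr

lemma RT.const (C : ℝ) : RT (fun _ => C) 0 := fun ε hε => by
  simpa using ev_exp C ε hε

lemma RT.mul {a b : ℕ → ℝ} {r r' : ℝ} (ha : RT a r) (hb : RT b r') (hb0 : ∀ n, 0 ≤ b n) :
    RT (fun n => a n * b n) (r + r') := fun ε hε => by
  filter_upwards [ha (ε/2) (by linarith), hb (ε/2) (by linarith)] with n h1 h2
  calc a n * b n ≤ Real.exp (n * (r + ε/2)) * Real.exp (n * (r' + ε/2)) := by
        have := hb0 n
        gcongr
    _ = _ := by rw [← Real.exp_add]; congr 1; ring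

lemma RT.cmul {a : ℕ → ℝ} {r : ℝ} (ha : RT a r) (ha0 : ∀ n, 0 ≤ a n) (C : ℝ) :
    RT (fun n => C * a n) r := by
  simpa using (RT.const C).mul ha ha0

lemma RT.add {a b : ℕ → ℝ} {r : ℝ} (ha : RT a r) (hb : RT b r) :
    RT (fun n => a n + b n) r := fun ε hε => by
  filter_upwards [ha (ε/2) (by linarith), hb (ε/2) (by linarith),
    ev_exp 2 (ε/2) (by linarith)] with n h1 h2 h3
  have e : Real.exp (n * (r + ε)) = Real.exp (n * (ε/2)) * Real.exp (n * (r + ε/2)) := by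
    rw [← Real.exp_add]; congr 1; ring
  rw [e]
  have := Real.exp_pos (n * (r + ε/2))
  nlinarith

lemma RT.zero (r : ℝ) : RT (fun _ => 0) r := fun _ _ => Eventually.of_forall fun _ =>
  (Real.exp_pos _).le

lemma RT.sum {ι : Type*} (S : Finset ι) {a : ι → ℕ → ℝ} {r : ℝ} (ha : ∀ i ∈ S, RT (a i) r) :
    RT (fun n => ∑ i ∈ S, a i n) r := by
  classical
  induction S using Finset.induction_on with
  | empty => simpa using RT.zero r
  | insert i S hi ih =>
    simp only [Finset.sum_insert hi]
    exact (ha i (by simp)).add (ih fun j hj => ha j (by simp [hj]))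

lemma RT.shift {a : ℕ → ℝ} {r : ℝ} (ha : RT a r) : RT (fun n => a (n+1)) r := fun ε hε => by
  have h1 := (tendsto_add_atTop_nat 1).eventually (ha (ε/2) (by linarith))
  obtain ⟨N, hN⟩ := exists_nat_gt ((r + ε/2)/(ε/2))
  filter_upwards [h1, eventually_ge_atTop N] with n h2 h3
  refine h2.trans (Real.exp_le_exp.mpr ?_)
  rw [div_lt_iff₀ (by linarith)] at hN
  have : (N:ℝ) ≤ n := by exact_mod_cast h3
  push_cast
  nlinarith

lemma RT.of_log {a : ℕ → ℝ} {r : ℝ} (hpos : ∀ n, 0 < a n)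
    (h : Tendsto (fun n : ℕ => Real.log (a n) / n) atTop (𝓝 r)) : RT a r := fun ε hε => by
  filter_upwards [h.eventually (gt_mem_nhds (show r < r + ε by linarith)),
    eventually_gt_atTop 0] with n h1 h0
  have : (0:ℝ) < n := by exact_mod_cast h0
  rw [div_lt_iff₀ this] at h1
  rw [← Real.log_le_iff_le_exp (hpos n)]; linarith

lemma RT.of_log_inv {a : ℕ → ℝ} {r : ℝ} (hpos : ∀ n, 0 < a n)
    (h : Tendsto (fun n : ℕ => Real.log (a n) / n) atTop (𝓝 r)) : RT (fun n => (a n)⁻¹) (-r) := by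
  refine RT.of_log (fun n => inv_pos.mpr (hpos n)) ?_
  refine h.neg.congr fun n => ?_
  rw [Real.log_inv]; ring

lemma RT.tendsto {a : ℕ → ℝ} {r : ℝ} (hpos : ∀ n, 0 < a n) (h1 : RT a r)
    (h2 : RT (fun n => (a n)⁻¹) (-r)) :
    Tendsto (fun n : ℕ => Real.log (a n) / n) atTop (𝓝 r) := by
  rw [Metric.tendsto_atTop']
  intro ε hε
  have h := ((h1 (ε/2) (by linarith)).and (h2 (ε/2) (by linarith))).and (eventually_gt_atTop 0)
  obtain ⟨N, hN⟩ := eventually_atTop.mp h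
  refine ⟨N, fun n hn => ?_⟩
  obtain ⟨⟨k1, k2⟩, h0⟩ := hN n hn.le
  have hn0 : (0:ℝ) < n := by exact_mod_cast h0
  rw [← Real.log_le_iff_le_exp (hpos n)] at k1
  rw [← Real.log_le_iff_le_exp (inv_pos.mpr (hpos n)), Real.log_inv] at k2
  rw [Real.dist_eq, abs_lt]
  constructor
  · rw [lt_sub_iff_add_lt, lt_div_iff₀ hn0]; nlinarith
  · rw [sub_lt_iff_lt_add, div_lt_iff₀ hn0]; nlinarith

lemma RT.summable {a : ℕ → ℝ} {r : ℝ} (ha : RT a r) (ha0 : ∀ n, 0 ≤ a n) (hr : r < 0) :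
    Summable a := by
  have h := ha (-r/2) (by linarith)
  have hs : Summable (fun n : ℕ => Real.exp (n * (r/2))) := by
    have : (fun n : ℕ => Real.exp (n * (r/2))) = fun n : ℕ => (Real.exp (r/2))^n := by
      ext n; rw [← Real.exp_nat_mul]
    rw [this]
    exact summable_geometric_of_lt_one (Real.exp_pos _).le (by
      rw [Real.exp_lt_one_iff]; linarith)
  refine Summable.of_norm_bounded_eventually_nat hs ?_
  filter_upwards [h] with n hn
  rw [Real.norm_of_nonneg (ha0 n)]
  convert hn using 3; ring

lemma RT.telescope {a b : ℕ → ℝ} {r : ℝ} (hb : RT b r) (hr : r < 0)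
    (h : ∀ n, a n ≤ a (n+1) + b n) (ha : Tendsto a atTop (𝓝 0)) : RT a r := by
  intro ε hε
  set δ := min (ε/2) (-r/2) with hδ
  have hδ0 : 0 < δ := lt_min (by linarith) (by linarith)
  have hδ1 : δ ≤ ε/2 := min_le_left _ _
  have hδ2 : δ ≤ -r/2 := min_le_right _ _
  set ρ := Real.exp (r + δ) with hρ
  have hρ1 : ρ < 1 := by rw [hρ, Real.exp_lt_one_iff]; linarith
  have hρ0 : 0 < ρ := Real.exp_pos _
  have hpow : ∀ n : ℕ, Real.exp (n * (r + δ)) = ρ ^ n := fun n => by rw [Real.exp_nat_mul]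
  obtain ⟨N, hN⟩ := eventually_atTop.mp (hb δ hδ0)
  set c : ℕ → ℝ := fun n => a n - ρ ^ n / (1 - ρ) with hc
  have hmono : ∀ n, N ≤ n → c n ≤ c (n+1) := by
    intro n hn
    have h1 := hN n hn
    rw [hpow] at h1
    have h2 := h n
    have h3 : ρ ^ n / (1 - ρ) - ρ ^ (n+1) / (1-ρ) = ρ ^ n := by
      have : (1 - ρ) ≠ 0 := by linarith
      field_simp; ring
    simp only [hc]; linarith
  have hlim : Tendsto c atTop (𝓝 0) := by
    have := ha.sub ((tendsto_pow_atTop_nhds_zero_of_lt_one hρ0.le hρ1).div_const (1-ρ))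
    simpa using this
  have hle : ∀ n, N ≤ n → c n ≤ 0 := by
    intro n hn
    refine ge_of_tendsto hlim ?_
    filter_upwards [eventually_ge_atTop n] with m hm
    induction m, hm using Nat.le_induction with
    | base => exact le_rfl
    | succ m hm ih => exact ih.trans (hmono m (hn.trans hm))
  filter_upwards [eventually_ge_atTop N, ev_exp (1/(1-ρ)) (ε - δ) (by linarith)] with n hn h1
  have h2 := hle n hn
  simp only [hc] at h2
  calc a n ≤ ρ ^ n * (1 / (1-ρ)) := by rw [mul_one_div]; linarith
    _ ≤ Real.exp (n * (r + δ)) * Real.exp (n * (ε - δ)) := by rw [hpow]; gcongr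
    _ = _ := by rw [← Real.exp_add]; congr 1; ring

end Rates

section Det

variable {d : ℕ}

lemma eNorm_eq (x : Fin d → ℝ) : eNorm x = ‖WithLp.toLp 2 x‖ := by
  rw [EuclideanSpace.norm_eq]; simp [eNorm]

lemma eNorm_nonneg (x : Fin d → ℝ) : 0 ≤ eNorm x := Real.sqrt_nonneg _

lemma eNorm_sq (x : Fin d → ℝ) : eNorm x ^ 2 = ∑ i, x i ^ 2 :=
  Real.sq_sqrt (Finset.sum_nonneg fun _ _ => sq_nonneg _)

lemma eNorm_sq' (x : Fin d → ℝ) : eNorm x ^ 2 = x ⬝ᵥ x := by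
  rw [eNorm_sq]; simp [dotProduct, sq]

lemma eNorm_add (x y : Fin d → ℝ) : eNorm (x + y) ≤ eNorm x + eNorm y := by
  rw [eNorm_eq, eNorm_eq, eNorm_eq, WithLp.toLp_add]; exact norm_add_le _ _

lemma abs_le_eNorm (x : Fin d → ℝ) (i : Fin d) : |x i| ≤ eNorm x := by
  rw [eNorm, ← Real.sqrt_sq_eq_abs]
  exact Real.sqrt_le_sqrt (Finset.single_le_sum (f := fun i => x i ^ 2)
    (fun _ _ => sq_nonneg _) (Finset.mem_univ i))

lemma eNorm_le_sum (x : Fin d → ℝ) : eNorm x ≤ ∑ i, |x i| := by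
  rw [eNorm]
  refine Real.sqrt_le_iff.mpr ⟨Finset.sum_nonneg fun _ _ => abs_nonneg _, ?_⟩
  have := Finset.sum_sq_le_sq_sum_of_nonneg (s := Finset.univ) (f := fun i => |x i|)
    (fun _ _ => abs_nonneg _)
  simpa using this

lemma eNorm_pos {x : Fin d → ℝ} (hx : x ≠ 0) : 0 < eNorm x := by
  rw [eNorm_eq]; simpa using hx

lemma eNorm_orth (U : Matrix (Fin d) (Fin d) ℝ) (hU : Uᵀ * U = 1) (x : Fin d → ℝ) :
    eNorm (U *ᵥ x) = eNorm x := by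
  have : eNorm (U *ᵥ x) ^ 2 = eNorm x ^ 2 := by
    rw [eNorm_sq', eNorm_sq', dotProduct_mulVec, vecMul_mulVec, ← dotProduct_mulVec, hU,
      one_mulVec]
  exact (sq_eq_sq₀ (eNorm_nonneg _) (eNorm_nonneg _)).mp this

lemma eNorm_cont : Continuous (fun x : Fin d → ℝ => eNorm x) := by
  unfold eNorm; fun_prop

/-- entry sum norm -/
def nrm (M : Matrix (Fin d) (Fin d) ℝ) : ℝ := ∑ i, ∑ j, |M i j|

lemma nrm_nonneg (M : Matrix (Fin d) (Fin d) ℝ) : 0 ≤ nrm M :=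
  Finset.sum_nonneg fun _ _ => Finset.sum_nonneg fun _ _ => abs_nonneg _

lemma eNorm_mulVec_le (M : Matrix (Fin d) (Fin d) ℝ) (x : Fin d → ℝ) :
    eNorm (M *ᵥ x) ≤ nrm M * eNorm x := by
  refine (eNorm_le_sum _).trans ?_
  rw [nrm, Finset.sum_mul]
  refine Finset.sum_le_sum fun i _ => ?_
  rw [Finset.sum_mul]
  simp only [mulVec, dotProduct]
  refine (Finset.abs_sum_le_sum_abs _ _).trans (Finset.sum_le_sum fun j _ => ?_)
  rw [abs_mul]
  exact mul_le_mul_of_nonneg_left (abs_le_eNorm x j) (abs_nonneg _)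

lemma svd_norm {T U : Matrix (Fin d) (Fin d) ℝ} {s : Fin d → ℝ}
    (h : Tᵀ * T = U * diagonal (fun i => s i ^ 2) * Uᵀ) (x : Fin d → ℝ) :
    eNorm (T *ᵥ x) = eNorm (fun i => s i * (Uᵀ *ᵥ x) i) := by
  have : eNorm (T *ᵥ x) ^ 2 = eNorm (fun i => s i * (Uᵀ *ᵥ x) i) ^ 2 := by
    rw [eNorm_sq', dotProduct_mulVec, vecMul_mulVec, ← dotProduct_mulVec, h, eNorm_sq,
      ← mulVec_mulVec, ← mulVec_mulVec, dotProduct_mulVec, ← mulVec_transpose]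
    simp only [dotProduct, mulVec_diagonal]
    refine Finset.sum_congr rfl fun i _ => ?_
    ring
  exact (sq_eq_sq₀ (eNorm_nonneg _) (eNorm_nonneg _)).mp this

lemma svd_coord_le {T U : Matrix (Fin d) (Fin d) ℝ} {s : Fin d → ℝ} (hpos : ∀ i, 0 < s i)
    (h : Tᵀ * T = U * diagonal (fun i => s i ^ 2) * Uᵀ) (x : Fin d → ℝ) (i : Fin d) :
    s i * |(Uᵀ *ᵥ x) i| ≤ eNorm (T *ᵥ x) := by
  rw [svd_norm h x]
  have := abs_le_eNorm (fun i => s i * (Uᵀ *ᵥ x) i) i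
  rwa [abs_mul, abs_of_pos (hpos i)] at this

lemma svd_le_sum {T U : Matrix (Fin d) (Fin d) ℝ} {s : Fin d → ℝ} (hpos : ∀ i, 0 < s i)
    (h : Tᵀ * T = U * diagonal (fun i => s i ^ 2) * Uᵀ) (x : Fin d → ℝ) :
    eNorm (T *ᵥ x) ≤ ∑ i, s i * |(Uᵀ *ᵥ x) i| := by
  rw [svd_norm h x]
  refine (eNorm_le_sum _).trans (Finset.sum_le_sum fun i _ => ?_)
  rw [abs_mul, abs_of_pos (hpos i)]

lemma svd_basis {T U : Matrix (Fin d) (Fin d) ℝ} {s : Fin d → ℝ} (hpos : ∀ i, 0 < s i)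
    (hU : Uᵀ * U = 1)
    (h : Tᵀ * T = U * diagonal (fun i => s i ^ 2) * Uᵀ) (l : Fin d) :
    eNorm (T *ᵥ (U *ᵥ Pi.single l 1)) ≤ s l := by
  refine (svd_le_sum hpos h _).trans ?_
  rw [mulVec_mulVec, hU, one_mulVec, Finset.sum_eq_single l]
  · simp
  · intro b _ hb; simp [hb]
  · simp

/-- data for the deterministic part -/
structure Data (d : ℕ) where
  T : ℕ → Matrix (Fin d) (Fin d) ℝ
  U : ℕ → Matrix (Fin d) (Fin d) ℝ
  s : ℕ → Fin d → ℝ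
  A : ℕ → Matrix (Fin d) (Fin d) ℝ
  B : ℕ → Matrix (Fin d) (Fin d) ℝ
  χ : Fin d → ℝ
  hU : ∀ n, (U n)ᵀ * U n = 1
  hpos : ∀ n i, 0 < s n i
  hsvd : ∀ n, (T n)ᵀ * T n = U n * diagonal (fun i => s n i ^ 2) * (U n)ᵀ
  hA : ∀ n, T (n+1) = A n * T n
  hB : ∀ n, T n = B n * T (n+1)
  rA : RT (fun n => nrm (A n)) 0
  rB : RT (fun n => nrm (B n)) 0
  hχ : ∀ i, Tendsto (fun n : ℕ => Real.log (s n i) / n) atTop (𝓝 (χ i))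

namespace Data
variable (D : Data d)

lemma hU' (n : ℕ) : D.U n * (D.U n)ᵀ = 1 := mul_eq_one_comm.mp (D.hU n)

/-- cross matrix -/
def C (n : ℕ) : Matrix (Fin d) (Fin d) ℝ := (D.U n)ᵀ * D.U (n+1)

lemma C_orth (n : ℕ) : (D.C n)ᵀ * D.C n = 1 := by
  rw [C, transpose_mul, transpose_transpose, Matrix.mul_assoc, ← Matrix.mul_assoc (D.U n),
    hU', Matrix.one_mul, D.hU]

lemma C_single (n : ℕ) (j l : Fin d) : ((D.U n)ᵀ *ᵥ (D.U (n+1) *ᵥ Pi.single l 1)) j = D.C n j l := by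
  rw [mulVec_mulVec, ← C, mulVec_single_one]; rfl

lemma C_single' (n : ℕ) (j l : Fin d) :
    ((D.U (n+1))ᵀ *ᵥ (D.U n *ᵥ Pi.single j 1)) l = D.C n j l := by
  rw [mulVec_mulVec, mulVec_single_one]
  have : (D.U (n+1))ᵀ * D.U n = (D.C n)ᵀ := by rw [C, transpose_mul, transpose_transpose]
  rw [this]; rfl

lemma rs (i : Fin d) : RT (fun n => D.s n i) (D.χ i) := RT.of_log (fun n => D.hpos n i) (D.hχ i)
lemma rsi (i : Fin d) : RT (fun n => (D.s n i)⁻¹) (-D.χ i) :=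
  RT.of_log_inv (fun n => D.hpos n i) (D.hχ i)

lemma rC1 (j l : Fin d) : RT (fun n => |D.C n j l|) (D.χ l - D.χ j) := by
  have h := (D.rB.mul (D.rs l).shift (fun n => (D.hpos _ _).le)).mul (D.rsi j)
    (fun n => (inv_pos.mpr (D.hpos _ _)).le)
  refine (h.mono (by linarith)).of_le (Eventually.of_forall fun n => ?_)
  rw [← div_eq_mul_inv, le_div_iff₀ (D.hpos n j), mul_comm, ← C_single]
  refine (svd_coord_le (D.hpos n) (D.hsvd n) _ j).trans ?_
  rw [D.hB n, ← mulVec_mulVec]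
  refine (eNorm_mulVec_le _ _).trans ?_
  exact mul_le_mul_of_nonneg_left (svd_basis (D.hpos _) (D.hU _) (D.hsvd _) l) (nrm_nonneg _)

lemma rC2 (j l : Fin d) : RT (fun n => |D.C n j l|) (D.χ j - D.χ l) := by
  have h := (D.rA.mul (D.rs j) (fun n => (D.hpos _ _).le)).mul (D.rsi l).shift
    (fun n => (inv_pos.mpr (D.hpos _ _)).le)
  refine (h.mono (by linarith)).of_le (Eventually.of_forall fun n => ?_)
  rw [← div_eq_mul_inv, le_div_iff₀ (D.hpos _ l), mul_comm, ← C_single']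
  refine (svd_coord_le (D.hpos (n+1)) (D.hsvd (n+1)) _ l).trans ?_
  rw [D.hA n, ← mulVec_mulVec]
  refine (eNorm_mulVec_le _ _).trans ?_
  exact mul_le_mul_of_nonneg_left (svd_basis (D.hpos _) (D.hU _) (D.hsvd _) j) (nrm_nonneg _)

lemma C_summable (j l : Fin d) (h : D.χ j ≠ D.χ l) : Summable (fun n => |D.C n j l|) := by
  rcases lt_or_gt_of_ne h with h | h
  · exact (D.rC2 j l).summable (fun _ => abs_nonneg _) (by linarith)
  · exact (D.rC1 j l).summable (fun _ => abs_nonneg _) (by linarith)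

/-- weighted conjugate -/
def W (w : Fin d → ℝ) (n : ℕ) : Matrix (Fin d) (Fin d) ℝ := D.U n * diagonal w * (D.U n)ᵀ

lemma W_diff (w : Fin d → ℝ) (n : ℕ) : D.W w (n+1) - D.W w n =
    D.U (n+1) * (diagonal w * (D.C n)ᵀ - (D.C n)ᵀ * diagonal w) * (D.U n)ᵀ := by
  have e1 : (D.C n)ᵀ = (D.U (n+1))ᵀ * D.U n := by rw [C, transpose_mul, transpose_transpose]
  rw [e1, Matrix.mul_sub, Matrix.sub_mul, W, W]
  congr 1
  · simp only [Matrix.mul_assoc]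
    rw [hU', Matrix.mul_one]
  · simp only [← Matrix.mul_assoc]
    rw [hU', Matrix.one_mul]

lemma W_conv (w : Fin d → ℝ) (hw : ∀ j l, D.χ j = D.χ l → w j = w l) :
    ∃ M, Tendsto (D.W w) atTop (𝓝 M) := by
  have hb : ∀ a b n, |D.W w (n+1) a b - D.W w n a b| ≤
      ∑ j, ∑ l, |w l - w j| * |D.C n j l| := by
    intro a b n
    have e : D.W w (n+1) a b - D.W w n a b = (D.W w (n+1) - D.W w n) a b := rfl
    rw [e, W_diff, Matrix.mul_apply]
    refine (Finset.abs_sum_le_sum_abs _ _).trans (Finset.sum_le_sum fun j _ => ?_)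
    rw [abs_mul]
    have h1 : |(D.U n)ᵀ j b| ≤ 1 := by
      rw [transpose_apply]
      have h : ((D.U n)ᵀ * D.U n) j j = 1 := by rw [D.hU]; simp
      rw [Matrix.mul_apply] at h
      have h2 : D.U n b j * D.U n b j ≤ ∑ a, (D.U n)ᵀ j a * D.U n a j := by
        refine Finset.single_le_sum (f := fun a => (D.U n)ᵀ j a * D.U n a j) (fun a _ => ?_)
          (Finset.mem_univ b)
        simp only [transpose_apply]; exact mul_self_nonneg _
      rw [h] at h2
      rw [abs_le_one_iff_mul_self_le_one]; exact h2
    refine (mul_le_of_le_one_right (abs_nonneg _) h1).trans ?_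
    rw [Matrix.mul_apply]
    refine (Finset.abs_sum_le_sum_abs _ _).trans (Finset.sum_le_sum fun l _ => ?_)
    rw [abs_mul]
    have h1 : |D.U (n+1) a l| ≤ 1 := by
      have h : ((D.U (n+1))ᵀ * D.U (n+1)) l l = 1 := by rw [D.hU]; simp
      rw [Matrix.mul_apply] at h
      have h2 : D.U (n+1) a l * D.U (n+1) a l ≤ ∑ a, (D.U (n+1))ᵀ l a * D.U (n+1) a l := by
        refine Finset.single_le_sum (f := fun a => (D.U (n+1))ᵀ l a * D.U (n+1) a l)
          (fun a _ => ?_) (Finset.mem_univ a)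
        simp only [transpose_apply]; exact mul_self_nonneg _
      rw [h] at h2
      rw [abs_le_one_iff_mul_self_le_one]; exact h2
    refine (mul_le_of_le_one_left (abs_nonneg _) h1).trans ?_
    rw [Matrix.sub_apply, diagonal_mul, mul_diagonal, transpose_apply, ← abs_mul]
    apply le_of_eq; congr 1; ring
  have hs : Summable (fun n => ∑ j, ∑ l, |w l - w j| * |D.C n j l|) := by
    refine summable_sum fun j _ => summable_sum fun l _ => ?_
    by_cases h : D.χ j = D.χ l
    · rw [hw j l h]; simpa using summable_zero
    · exact (D.C_summable j l h).mul_left _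
  have hc : ∀ a b, ∃ m, Tendsto (fun n => D.W w n a b) atTop (𝓝 m) := by
    intro a b
    refine cauchySeq_tendsto_of_complete ?_
    refine cauchySeq_of_summable_dist ?_
    refine Summable.of_nonneg_of_le (fun _ => dist_nonneg) (fun n => ?_) hs
    rw [dist_comm, Real.dist_eq]; exact hb a b n
  choose M hM using hc
  exact ⟨Matrix.of M, tendsto_pi_nhds.mpr fun a => tendsto_pi_nhds.mpr fun b => hM a b⟩

lemma U_subseq : ∃ (V : Matrix (Fin d) (Fin d) ℝ) (ψ : ℕ → ℕ), Vᵀ * V = 1 ∧ StrictMono ψ ∧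
    Tendsto (D.U ∘ ψ) atTop (𝓝 V) := by
  have hK : IsCompact (Set.pi Set.univ fun _ : Fin d => Set.pi Set.univ fun _ : Fin d =>
      Set.Icc (-1:ℝ) 1) :=
    isCompact_univ_pi fun _ => isCompact_univ_pi fun _ => isCompact_Icc
  have hmem : ∀ n, D.U n ∈ (Set.pi Set.univ fun _ : Fin d => Set.pi Set.univ fun _ : Fin d =>
      Set.Icc (-1:ℝ) 1) := by
    intro n a _ l _
    rw [Set.mem_Icc, ← abs_le]
    have h : ((D.U n)ᵀ * D.U n) l l = 1 := by rw [D.hU]; simp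
    rw [Matrix.mul_apply] at h
    have h2 : D.U n a l * D.U n a l ≤ ∑ a, (D.U n)ᵀ l a * D.U n a l := by
      refine Finset.single_le_sum (f := fun a => (D.U n)ᵀ l a * D.U n a l)
        (fun a _ => ?_) (Finset.mem_univ a)
      simp only [transpose_apply]; exact mul_self_nonneg _
    rw [h] at h2
    rw [abs_le_one_iff_mul_self_le_one]; exact h2
  obtain ⟨V, ψ, hψ, hV⟩ : ∃ (V : Matrix (Fin d) (Fin d) ℝ) (ψ : ℕ → ℕ), StrictMono ψ ∧
      Tendsto (D.U ∘ ψ) atTop (𝓝 V) := by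
    obtain ⟨V, -, ψ, hψ, hV⟩ := hK.tendsto_subseq hmem
    exact ⟨V, ψ, hψ, hV⟩
  refine ⟨V, ψ, ?_, hψ, hV⟩
  have hcont : Continuous (fun M : Matrix (Fin d) (Fin d) ℝ => Mᵀ * M) := by fun_prop
  have h1 := (hcont.tendsto V).comp hV
  refine tendsto_nhds_unique h1 ?_
  have : ((fun M : Matrix (Fin d) (Fin d) ℝ => Mᵀ * M) ∘ (D.U ∘ ψ)) = fun _ => 1 := by
    funext n; exact D.hU _
  rw [this]; exact tendsto_const_nhds

end Data

end Det
end MET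

namespace MET
namespace Data
variable {d : ℕ} (D : Data d)

lemma W_lim {V : Matrix (Fin d) (Fin d) ℝ} {ψ : ℕ → ℕ} (hψ : StrictMono ψ)
    (hV : Tendsto (D.U ∘ ψ) atTop (𝓝 V)) (w : Fin d → ℝ)
    (hw : ∀ j l, D.χ j = D.χ l → w j = w l) :
    Tendsto (D.W w) atTop (𝓝 (V * diagonal w * Vᵀ)) := by
  obtain ⟨M, hM⟩ := D.W_conv w hw
  have hcont : Continuous (fun M : Matrix (Fin d) (Fin d) ℝ => M * diagonal w * Mᵀ) := by fun_prop
  have h1 := (hcont.tendsto V).comp hV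
  have h2 := hM.comp hψ.tendsto_atTop
  have : M = V * diagonal w * Vᵀ := tendsto_nhds_unique h2 h1
  rwa [← this]

lemma eNorm_W (U : Matrix (Fin d) (Fin d) ℝ) (hU : Uᵀ * U = 1) (w x : Fin d → ℝ) :
    eNorm ((U * diagonal w * Uᵀ) *ᵥ x) = eNorm (fun i => w i * (Uᵀ *ᵥ x) i) := by
  rw [← mulVec_mulVec, ← mulVec_mulVec, eNorm_orth U hU]
  congr 1; ext i; rw [mulVec_diagonal]

lemma h_lim {V : Matrix (Fin d) (Fin d) ℝ} {ψ : ℕ → ℕ} (hVo : Vᵀ * V = 1) (hψ : StrictMono ψ)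
    (hV : Tendsto (D.U ∘ ψ) atTop (𝓝 V)) (w : Fin d → ℝ)
    (hw : ∀ j l, D.χ j = D.χ l → w j = w l) (x : Fin d → ℝ) :
    Tendsto (fun n => eNorm (fun i => w i * ((D.U n)ᵀ *ᵥ x) i)) atTop
      (𝓝 (eNorm (fun i => w i * (Vᵀ *ᵥ x) i))) := by
  have hc : Continuous (fun M : Matrix (Fin d) (Fin d) ℝ => eNorm (M *ᵥ x)) :=
    eNorm_cont.comp (by fun_prop)
  have h := (hc.tendsto _).comp (D.W_lim hψ hV w hw)
  rw [← eNorm_W V hVo]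
  refine h.congr fun n => ?_
  rw [← eNorm_W (D.U n) (D.hU n)]; rfl

lemma eNorm_mono {x y : Fin d → ℝ} (h : ∀ i, |x i| ≤ |y i|) : eNorm x ≤ eNorm y :=
  Real.sqrt_le_sqrt (Finset.sum_le_sum fun i _ => sq_le_sq.mpr (h i))

lemma c_rec (n : ℕ) (x : Fin d → ℝ) : (D.U n)ᵀ *ᵥ x = D.C n *ᵥ ((D.U (n+1))ᵀ *ᵥ x) := by
  rw [mulVec_mulVec, C, Matrix.mul_assoc, hU', Matrix.mul_one]

lemma h_rec (w : Fin d → ℝ) (hw : ∀ i, w i = 0 ∨ w i = 1) (n : ℕ) (x : Fin d → ℝ) :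
    eNorm (fun i => w i * ((D.U n)ᵀ *ᵥ x) i) ≤
      eNorm (fun i => w i * ((D.U (n+1))ᵀ *ᵥ x) i) +
      ∑ j, ∑ l, (w j * (1 - w l)) * (|D.C n j l| * |((D.U (n+1))ᵀ *ᵥ x) l|) := by
  rw [D.c_rec n x]
  set c := (D.U (n+1))ᵀ *ᵥ x with hc
  have h0 : ∀ i, 0 ≤ w i := fun i => by rcases hw i with h | h <;> rw [h] <;> norm_num
  have h1 : ∀ i, w i ≤ 1 := fun i => by rcases hw i with h | h <;> rw [h] <;> norm_num
  have e : (fun i => w i * (D.C n *ᵥ c) i) = (fun i => w i * (D.C n *ᵥ (fun l => w l * c l)) i) +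
      (fun i => w i * (D.C n *ᵥ (fun l => (1 - w l) * c l)) i) := by
    ext i
    simp only [Pi.add_apply, mulVec, dotProduct, Finset.mul_sum]
    rw [← Finset.sum_add_distrib]
    exact Finset.sum_congr rfl fun l _ => by ring
  rw [e]
  refine (eNorm_add _ _).trans (add_le_add ?_ ?_)
  · rw [← eNorm_orth (D.C n) (D.C_orth n) (fun i => w i * c i)]
    refine eNorm_mono fun i => ?_
    rw [abs_mul, abs_of_nonneg (h0 i)]
    exact mul_le_of_le_one_left (abs_nonneg _) (h1 i)
  · refine (eNorm_le_sum _).trans (Finset.sum_le_sum fun j _ => ?_)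
    simp only [mulVec, dotProduct, Finset.mul_sum]
    refine (Finset.abs_sum_le_sum_abs _ _).trans (Finset.sum_le_sum fun l _ => ?_)
    rw [abs_mul, abs_mul, abs_mul, abs_of_nonneg (h0 j), abs_of_nonneg (sub_nonneg.mpr (h1 l))]
    apply le_of_eq; ring

open Classical in
/-- indicator of a superlevel set -/
def ind (a : ℝ) (i : Fin d) : ℝ := if a ≤ D.χ i then 1 else 0

lemma coord_rate {V : Matrix (Fin d) (Fin d) ℝ} {ψ : ℕ → ℕ} (hVo : Vᵀ * V = 1)
    (hψ : StrictMono ψ) (hV : Tendsto (D.U ∘ ψ) atTop (𝓝 V)) (x : Fin d → ℝ) (lam : ℝ)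
    (hx : ∀ j, (Vᵀ *ᵥ x) j ≠ 0 → D.χ j ≤ lam) (i : Fin d) (hi : lam < D.χ i) :
    RT (fun n => eNorm (fun j => D.ind (D.χ i) j * ((D.U n)ᵀ *ᵥ x) j)) (lam - D.χ i) := by
  have hwf : WellFounded (InvImage (· < ·) D.χ) := by
    have : Std.Irrefl (InvImage (· < ·) D.χ) := ⟨fun a => lt_irrefl (D.χ a)⟩
    have : IsTrans (Fin d) (InvImage (· < ·) D.χ) := ⟨fun a b c h1 h2 => lt_trans (α := ℝ) h1 h2⟩
    exact Finite.wellFounded_of_trans_of_irrefl _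
  induction i using hwf.induction with
  | _ i ih =>
  have hw : ∀ j, D.ind (D.χ i) j = 0 ∨ D.ind (D.χ i) j = 1 := fun j => by
    unfold ind; split_ifs <;> simp
  refine RT.telescope (b := fun n => ∑ j, ∑ l, (D.ind (D.χ i) j * (1 - D.ind (D.χ i) l)) *
    (|D.C n j l| * |((D.U (n+1))ᵀ *ᵥ x) l|)) ?_ (by linarith) (fun n => D.h_rec _ hw n x) ?_
  · refine RT.sum _ fun j _ => RT.sum _ fun l _ => ?_
    by_cases h1 : D.χ i ≤ D.χ j
    swap
    · simpa [ind, h1] using RT.zero _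
    by_cases h2 : D.χ i ≤ D.χ l
    · simpa [ind, h2] using RT.zero _
    refine RT.cmul ?_ (fun n => by positivity) _
    push Not at h2
    by_cases h3 : lam < D.χ l
    · have h4 : RT (fun n => |((D.U n)ᵀ *ᵥ x) l|) (lam - D.χ l) :=
        (ih l h2 h3).of_le (Eventually.of_forall fun n => by
          have := abs_le_eNorm (fun j => D.ind (D.χ l) j * ((D.U n)ᵀ *ᵥ x) j) l
          simpa [ind] using this)
      exact ((D.rC1 j l).mul h4.shift fun n => abs_nonneg _).mono (by linarith)
    · push Not at h3
      have h4 : RT (fun n => |((D.U (n+1))ᵀ *ᵥ x) l|) 0 :=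
        (RT.const (eNorm x)).of_le (Eventually.of_forall fun n => by
          have := abs_le_eNorm ((D.U (n+1))ᵀ *ᵥ x) l
          rwa [eNorm_orth _ (by rw [transpose_transpose]; exact D.hU' _)] at this)
      exact ((D.rC1 j l).mul h4 fun n => abs_nonneg _).mono (by linarith)
  · have := D.h_lim hVo hψ hV (D.ind (D.χ i)) (fun j l h => by unfold ind; rw [h]) x
    convert this using 2
    have : (fun j => D.ind (D.χ i) j * (Vᵀ *ᵥ x) j) = fun _ => 0 := by
      ext j
      by_cases h : (Vᵀ *ᵥ x) j = 0
      · rw [h, mul_zero]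
      · have := hx j h
        rw [ind, if_neg (by linarith), zero_mul]
    rw [this]; simp [eNorm]

lemma upper {V : Matrix (Fin d) (Fin d) ℝ} {ψ : ℕ → ℕ} (hVo : Vᵀ * V = 1)
    (hψ : StrictMono ψ) (hV : Tendsto (D.U ∘ ψ) atTop (𝓝 V)) (x : Fin d → ℝ) (lam : ℝ)
    (hx : ∀ j, (Vᵀ *ᵥ x) j ≠ 0 → D.χ j ≤ lam) :
    RT (fun n => eNorm (D.T n *ᵥ x)) lam := by
  refine RT.of_le (b := fun n => ∑ i, D.s n i * |((D.U n)ᵀ *ᵥ x) i|) ?_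
    (Eventually.of_forall fun n => svd_le_sum (D.hpos n) (D.hsvd n) x)
  refine RT.sum _ fun i _ => ?_
  by_cases h3 : lam < D.χ i
  · have h4 : RT (fun n => |((D.U n)ᵀ *ᵥ x) i|) (lam - D.χ i) :=
      (D.coord_rate hVo hψ hV x lam hx i h3).of_le (Eventually.of_forall fun n => by
        have := abs_le_eNorm (fun j => D.ind (D.χ i) j * ((D.U n)ᵀ *ᵥ x) j) i
        simpa [ind] using this)
    exact ((D.rs i).mul h4 fun n => abs_nonneg _).mono (by linarith)
  · push Not at h3
    have h4 : RT (fun n => |((D.U n)ᵀ *ᵥ x) i|) 0 :=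
      (RT.const (eNorm x)).of_le (Eventually.of_forall fun n => by
        have := abs_le_eNorm ((D.U n)ᵀ *ᵥ x) i
        rwa [eNorm_orth _ (by rw [transpose_transpose]; exact D.hU' _)] at this)
    exact ((D.rs i).mul h4 fun n => abs_nonneg _).mono (by linarith)

open Classical in
lemma lower {V : Matrix (Fin d) (Fin d) ℝ} {ψ : ℕ → ℕ} (hVo : Vᵀ * V = 1)
    (hψ : StrictMono ψ) (hV : Tendsto (D.U ∘ ψ) atTop (𝓝 V)) (x : Fin d → ℝ) (lam : ℝ)
    (hx : ∃ j, (Vᵀ *ᵥ x) j ≠ 0 ∧ D.χ j = lam) (hp : ∀ n, 0 < eNorm (D.T n *ᵥ x)) :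
    RT (fun n => (eNorm (D.T n *ᵥ x))⁻¹) (-lam) := by
  obtain ⟨k, hk, hkl⟩ := hx
  set w : Fin d → ℝ := fun i => if D.χ i = lam then 1 else 0 with hw
  have hlim := D.h_lim hVo hψ hV w (fun j l h => by simp only [hw]; rw [h]) x
  set L := eNorm (fun i => w i * (Vᵀ *ᵥ x) i) with hL
  have hLp : 0 < L := by
    apply eNorm_pos
    intro h
    have := congrFun h k
    simp [hw, hkl] at this
    exact hk this
  have hr : RT (fun n => ∑ i, w i * (D.s n i)⁻¹) (-lam) := by
    refine RT.sum _ fun i _ => ?_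
    by_cases h : D.χ i = lam
    · have := D.rsi i
      rw [h] at this
      simpa [hw, h] using this
    · simpa [hw, h] using RT.zero _
  have hs0 : ∀ n, 0 ≤ ∑ i, w i * (D.s n i)⁻¹ := fun n => Finset.sum_nonneg fun i _ =>
    mul_nonneg (by simp only [hw]; split_ifs <;> norm_num) (inv_pos.mpr (D.hpos n i)).le
  refine (hr.cmul hs0 (2/L)).of_le ?_
  filter_upwards [hlim.eventually (lt_mem_nhds (show L/2 < L by linarith))] with n hn
  have h1 : eNorm (fun i => w i * ((D.U n)ᵀ *ᵥ x) i) ≤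
      eNorm (D.T n *ᵥ x) * ∑ i, w i * (D.s n i)⁻¹ := by
    refine (eNorm_le_sum _).trans ?_
    rw [Finset.mul_sum]
    refine Finset.sum_le_sum fun i _ => ?_
    have h0 : 0 ≤ w i := by simp only [hw]; split_ifs <;> norm_num
    rw [abs_mul, abs_of_nonneg h0, mul_left_comm]
    refine mul_le_mul_of_nonneg_left ?_ h0
    rw [← div_eq_mul_inv, le_div_iff₀ (D.hpos n i), mul_comm]
    exact svd_coord_le (D.hpos n) (D.hsvd n) x i
  rw [inv_le_iff_one_le_mul₀ (hp n)]
  have h2 : L/2 ≤ eNorm (D.T n *ᵥ x) * ∑ i, w i * (D.s n i)⁻¹ := hn.le.trans h1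
  calc (1:ℝ) = 2 / L * (L/2) := by field_simp
    _ ≤ 2 / L * (eNorm (D.T n *ᵥ x) * ∑ i, w i * (D.s n i)⁻¹) :=
        mul_le_mul_of_nonneg_left h2 (by positivity)
    _ = _ := by ring

lemma T_pos {x : Fin d → ℝ} (hx : x ≠ 0) (n : ℕ) : 0 < eNorm (D.T n *ᵥ x) := by
  rw [svd_norm (D.hsvd n)]
  apply eNorm_pos
  intro h
  have h1 : (D.U n)ᵀ *ᵥ x = 0 := by
    ext i
    have := congrFun h i
    simpa [(D.hpos n i).ne'] using this
  apply hx
  rw [← one_mulVec x, ← D.hU' n, ← mulVec_mulVec, h1, mulVec_zero]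

/-- the roots -/
def R (n : ℕ) : Matrix (Fin d) (Fin d) ℝ :=
  D.U n * diagonal (fun i => Real.exp (Real.log (D.s n i) / n)) * (D.U n)ᵀ

lemma U_le (n : ℕ) (a l : Fin d) : |D.U n a l| ≤ 1 := by
  have h : ((D.U n)ᵀ * D.U n) l l = 1 := by rw [D.hU]; simp
  rw [Matrix.mul_apply] at h
  have h2 : D.U n a l * D.U n a l ≤ ∑ a, (D.U n)ᵀ l a * D.U n a l := by
    refine Finset.single_le_sum (f := fun a => (D.U n)ᵀ l a * D.U n a l)
      (fun a _ => ?_) (Finset.mem_univ a)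
    simp only [transpose_apply]; exact mul_self_nonneg _
  rw [h] at h2
  rw [abs_le_one_iff_mul_self_le_one]; exact h2

lemma R_lim {V : Matrix (Fin d) (Fin d) ℝ} {ψ : ℕ → ℕ} (hψ : StrictMono ψ)
    (hV : Tendsto (D.U ∘ ψ) atTop (𝓝 V)) :
    Tendsto D.R atTop (𝓝 (V * diagonal (fun i => Real.exp (D.χ i)) * Vᵀ)) := by
  have h1 := D.W_lim hψ hV (fun i => Real.exp (D.χ i)) (fun j l h => by rw [h])
  have h2 : Tendsto (fun n => D.R n - D.W (fun i => Real.exp (D.χ i)) n) atTop (𝓝 0) := by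
    refine tendsto_pi_nhds.mpr fun a => tendsto_pi_nhds.mpr fun b => ?_
    have hz : Tendsto (fun n : ℕ => ∑ i, |Real.exp (Real.log (D.s n i) / n) - Real.exp (D.χ i)|)
        atTop (𝓝 (∑ i : Fin d, |Real.exp (D.χ i) - Real.exp (D.χ i)|)) := by
      refine tendsto_finsetSum _ fun i _ => ?_
      exact (((Real.continuous_exp.tendsto _).comp (D.hχ i)).sub tendsto_const_nhds).abs
    simp only [sub_self, abs_zero, Finset.sum_const_zero] at hz
    refine squeeze_zero_norm (fun n => ?_) hz
    have e : (D.R n - D.W (fun i => Real.exp (D.χ i)) n) a b =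
        ∑ i, D.U n a i * (Real.exp (Real.log (D.s n i) / n) - Real.exp (D.χ i)) * D.U n b i := by
      rw [Matrix.sub_apply, R, W, Matrix.mul_apply, Matrix.mul_apply, ← Finset.sum_sub_distrib]
      refine Finset.sum_congr rfl fun i _ => ?_
      rw [mul_diagonal, mul_diagonal, transpose_apply]; ring
    rw [e, Real.norm_eq_abs]
    refine (Finset.abs_sum_le_sum_abs _ _).trans (Finset.sum_le_sum fun i _ => ?_)
    rw [abs_mul, abs_mul]
    have := D.U_le n a i
    have := D.U_le n b i
    calc _ ≤ 1 * |Real.exp (Real.log (D.s n i) / n) - Real.exp (D.χ i)| * 1 := by gcongr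
      _ = _ := by ring
  have h3 := h2.add h1
  rw [zero_add] at h3
  exact h3.congr fun n => by abel

lemma main : ∃ V : Matrix (Fin d) (Fin d) ℝ, Vᵀ * V = 1 ∧
    Tendsto D.R atTop (𝓝 (V * diagonal (fun i => Real.exp (D.χ i)) * Vᵀ)) ∧
    ∀ x : Fin d → ℝ, x ≠ 0 → ∀ lam, (∀ j, (Vᵀ *ᵥ x) j ≠ 0 → D.χ j ≤ lam) →
      (∃ j, (Vᵀ *ᵥ x) j ≠ 0 ∧ D.χ j = lam) →
      Tendsto (fun n : ℕ => Real.log (eNorm (D.T n *ᵥ x)) / n) atTop (𝓝 lam) := by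
  obtain ⟨V, ψ, hVo, hψ, hV⟩ := D.U_subseq
  refine ⟨V, hVo, D.R_lim hψ hV, fun x hx lam h1 h2 => ?_⟩
  exact RT.tendsto (D.T_pos hx) (D.upper hVo hψ hV x lam h1) (D.lower hVo hψ hV x lam h2 (D.T_pos hx))

end Data
end MET

namespace MET
section Spec
variable {d : ℕ} {V : Matrix (Fin d) (Fin d) ℝ}

lemma conj_symm (V : Matrix (Fin d) (Fin d) ℝ) (w : Fin d → ℝ) : (V * diagonal w * Vᵀ).IsSymm := by
  rw [Matrix.IsSymm, transpose_mul, transpose_mul, transpose_transpose, diagonal_transpose,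
    Matrix.mul_assoc]

lemma conj_pos (hV : Vᵀ * V = 1) (w : Fin d → ℝ) (hw : ∀ i, 0 < w i) :
    (V * diagonal w * Vᵀ).PosDef := by
  have h1 : (diagonal w).PosDef := PosDef.diagonal hw
  have h2 := h1.mul_mul_conjTranspose_same (B := V) (by
    intro x y h
    have h' := congrArg (fun z => z ᵥ* Vᵀ) h
    simp only [vecMul_vecMul, mul_eq_one_comm.mp hV, vecMul_one] at h'
    exact h')
  rwa [conjTranspose_eq_transpose_of_trivial] at h2

lemma conj_pow (hV : Vᵀ * V = 1) (w : Fin d → ℝ) (m : ℕ) :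
    (V * diagonal w * Vᵀ) ^ m = V * diagonal (fun i => w i ^ m) * Vᵀ := by
  induction m with
  | zero => simp [mul_eq_one_comm.mp hV]
  | succ m ih =>
    rw [pow_succ, ih]
    have : V * diagonal (fun i => w i ^ m) * Vᵀ * (V * diagonal w * Vᵀ) =
      V * diagonal (fun i => w i ^ m) * (Vᵀ * V) * diagonal w * Vᵀ := by
      simp only [Matrix.mul_assoc]
    rw [this, hV, Matrix.mul_one, Matrix.mul_assoc V, diagonal_mul_diagonal]
    simp only [pow_succ]

lemma mem_eig (hV : Vᵀ * V = 1) (w : Fin d → ℝ) (μ : ℝ) (x : Fin d → ℝ) :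
    x ∈ Module.End.eigenspace (Matrix.toLin' (V * diagonal w * Vᵀ)) μ ↔
      ∀ k, (Vᵀ *ᵥ x) k ≠ 0 → w k = μ := by
  rw [Module.End.mem_eigenspace_iff, toLin'_apply]
  constructor
  · intro h k hk
    have h1 := congrFun (congrArg (fun z => Vᵀ *ᵥ z) h) k
    simp only [← mulVec_mulVec, mulVec_smul] at h1
    rw [mulVec_mulVec, hV, one_mulVec, mulVec_diagonal, Pi.smul_apply, smul_eq_mul] at h1
    exact mul_right_cancel₀ hk h1
  · intro h
    have h1 : diagonal w *ᵥ (Vᵀ *ᵥ x) = μ • (Vᵀ *ᵥ x) := by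
      ext k
      rw [mulVec_diagonal, Pi.smul_apply, smul_eq_mul]
      by_cases hk : (Vᵀ *ᵥ x) k = 0
      · rw [hk]; simp
      · rw [h k hk]
    rw [← mulVec_mulVec, ← mulVec_mulVec, h1, mulVec_smul, mulVec_mulVec, mul_eq_one_comm.mp hV,
      one_mulVec]

lemma col_mem (hV : Vᵀ * V = 1) (w : Fin d → ℝ) (k : Fin d) (c : ℝ) :
    V *ᵥ Pi.single k c ∈ Module.End.eigenspace (Matrix.toLin' (V * diagonal w * Vᵀ)) (w k) := by
  rw [mem_eig hV]
  intro j hj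
  rw [mulVec_mulVec, hV, one_mulVec] at hj
  by_cases h : j = k
  · rw [h]
  · simp [h] at hj

lemma mem_sup (hV : Vᵀ * V = 1) (χ : Fin d → ℝ) {p : ℕ} (lam : Fin p → ℝ) (P : Fin p → Prop)
    (x : Fin d → ℝ) :
    (x ∈ ⨆ j : Fin p, ⨆ _ : P j, Module.End.eigenspace
      (Matrix.toLin' (V * diagonal (fun i => Real.exp (χ i)) * Vᵀ)) (Real.exp (lam j))) ↔
      ∀ k, (Vᵀ *ᵥ x) k ≠ 0 → ∃ j, P j ∧ χ k = lam j := by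
  constructor
  · intro hx
    let N : Submodule ℝ (Fin d → ℝ) :=
      { carrier := {x | ∀ k, (¬ ∃ j, P j ∧ χ k = lam j) → (Vᵀ *ᵥ x) k = 0}
        add_mem' := by
          intro a b ha hb k hk
          rw [mulVec_add, Pi.add_apply, ha k hk, hb k hk, add_zero]
        zero_mem' := by intro k _; simp
        smul_mem' := by
          intro c a ha k hk
          rw [mulVec_smul, Pi.smul_apply, ha k hk, smul_zero] }
    have hle : (⨆ j : Fin p, ⨆ _ : P j, Module.End.eigenspace
      (Matrix.toLin' (V * diagonal (fun i => Real.exp (χ i)) * Vᵀ)) (Real.exp (lam j))) ≤ N := by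
      refine iSup_le fun j => iSup_le fun hj => ?_
      intro y hy k hk
      rw [mem_eig hV] at hy
      by_contra h0
      exact hk ⟨j, hj, Real.exp_injective (hy k h0)⟩
    intro k hk
    by_contra h
    exact hk (hle hx k h)
  · intro h
    have e : x = ∑ k, V *ᵥ Pi.single k ((Vᵀ *ᵥ x) k) := by
      rw [← mulVec_sum, Finset.univ_sum_single, mulVec_mulVec, mul_eq_one_comm.mp hV, one_mulVec]
    rw [e]
    refine Submodule.sum_mem _ fun k _ => ?_
    by_cases hk : (Vᵀ *ᵥ x) k = 0
    · rw [hk]; simp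
    · obtain ⟨j, hj, hkj⟩ := h k hk
      refine Submodule.mem_iSup_of_mem j (Submodule.mem_iSup_of_mem hj ?_)
      rw [← hkj]
      exact col_mem hV (fun i => Real.exp (χ i)) k _

lemma exists_lam (χ : Fin d → ℝ) : ∃ (p : ℕ) (lam : Fin p → ℝ), StrictAnti lam ∧
    (∀ k, ∃ i, χ k = lam i) ∧ ∀ i, ∃ k, χ k = lam i := by
  classical
  let S := Finset.univ.image χ
  refine ⟨S.card, fun i => S.orderEmbOfFin rfl (Fin.rev i), ?_, ?_, ?_⟩
  · intro i j hij
    exact (S.orderEmbOfFin rfl).strictMono (Fin.rev_lt_rev.mpr hij)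
  · intro k
    have : χ k ∈ Set.range (S.orderEmbOfFin rfl) := by
      rw [Finset.range_orderEmbOfFin]; simp [S]
    obtain ⟨i, hi⟩ := this
    exact ⟨Fin.rev i, by simp only [Fin.rev_rev, hi]⟩
  · intro i
    have := S.orderEmbOfFin_mem rfl (Fin.rev i)
    obtain ⟨k, -, hk⟩ := Finset.mem_image.mp this
    exact ⟨k, hk⟩

theorem final (D : Data d) :
    ∃ Φ : Matrix (Fin d) (Fin d) ℝ, Φ.IsSymm ∧ Φ.PosDef ∧
      (∃ R : ℕ → Matrix (Fin d) (Fin d) ℝ,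
        (∀ n : ℕ, 1 ≤ n → (R n).IsSymm ∧ (R n).PosDef ∧
          R n ^ (2 * n) = (D.T n)ᵀ * D.T n) ∧
        Tendsto R atTop (𝓝 Φ)) ∧
      ∃ (p : ℕ) (lam : Fin p → ℝ), StrictAnti lam ∧
        (∀ μ : ℝ,
          Module.End.eigenspace (Matrix.toLin' Φ) μ ≠ ⊥ ↔ ∃ i : Fin p, μ = Real.exp (lam i)) ∧
        (∀ x : Fin d → ℝ, x ≠ 0 →
          (∃ l : ℝ,
            Tendsto (fun n : ℕ => (1 / (n : ℝ)) * Real.log (eNorm (D.T n *ᵥ x)))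
              atTop (𝓝 l)) ∧
          ∀ i : Fin p,
            (Tendsto (fun n : ℕ => (1 / (n : ℝ)) * Real.log (eNorm (D.T n *ᵥ x)))
              atTop (𝓝 (lam i)) ↔
            ((x ∈ ⨆ j : Fin p, ⨆ _ : i ≤ j,
                Module.End.eigenspace (Matrix.toLin' Φ) (Real.exp (lam j))) ∧
              x ∉ ⨆ j : Fin p, ⨆ _ : i < j,
                Module.End.eigenspace (Matrix.toLin' Φ) (Real.exp (lam j))))) := by
  obtain ⟨V, hV, hR, hx⟩ := D.main
  obtain ⟨p, lam, hanti, hl1, hl2⟩ := exists_lam D.χ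
  refine ⟨_, conj_symm V _, conj_pos hV _ (fun i => Real.exp_pos _),
    ⟨D.R, fun n hn => ⟨conj_symm _ _, conj_pos (D.hU n) _ (fun i => Real.exp_pos _), ?_⟩, hR⟩,
    p, lam, hanti, ?_, ?_⟩
  · rw [Data.R, conj_pow (D.hU n), D.hsvd n]
    have : (fun i => Real.exp (Real.log (D.s n i) / n) ^ (2 * n)) = fun i => D.s n i ^ 2 := by
      ext i
      have hn' : (n:ℝ) ≠ 0 := by positivity
      rw [mul_comm, pow_mul, ← Real.exp_nat_mul, mul_div_cancel₀ _ hn', Real.exp_log (D.hpos n i)]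
    rw [this]
  · intro μ
    constructor
    · intro h
      obtain ⟨x, hx, hx0⟩ := Submodule.exists_mem_ne_zero_of_ne_bot h
      rw [mem_eig hV] at hx
      have : ∃ k, (Vᵀ *ᵥ x) k ≠ 0 := by
        by_contra h0
        push Not at h0
        apply hx0
        have h1 : Vᵀ *ᵥ x = 0 := funext h0
        rw [← one_mulVec x, ← mul_eq_one_comm.mp hV, ← mulVec_mulVec, h1, mulVec_zero]
      obtain ⟨k, hk⟩ := this
      obtain ⟨i, hi⟩ := hl1 k
      exact ⟨i, by rw [← hx k hk, hi]⟩
    · rintro ⟨i, rfl⟩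
      obtain ⟨k, hk⟩ := hl2 i
      have := col_mem hV (fun i => Real.exp (D.χ i)) k 1
      rw [← hk]
      intro h0
      simp only [h0, Submodule.mem_bot] at this
      have h1 : Vᵀ *ᵥ (V *ᵥ Pi.single k 1) = 0 := by rw [this, mulVec_zero]
      rw [mulVec_mulVec, hV, one_mulVec] at h1
      have := congrFun h1 k
      simp at this
  · intro x hx0
    have hne : (Finset.univ.filter fun k => (Vᵀ *ᵥ x) k ≠ 0).Nonempty := by
      by_contra h0
      rw [Finset.not_nonempty_iff_eq_empty, Finset.filter_eq_empty_iff] at h0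
      apply hx0
      have h1 : Vᵀ *ᵥ x = 0 := funext fun k => by simpa using h0 (Finset.mem_univ k)
      rw [← one_mulVec x, ← mul_eq_one_comm.mp hV, ← mulVec_mulVec, h1, mulVec_zero]
    obtain ⟨k, hk, hmax⟩ := Finset.exists_max_image _ D.χ hne
    simp only [Finset.mem_filter, Finset.mem_univ, true_and] at hk hmax
    have hlim : Tendsto (fun n : ℕ => (1 / (n : ℝ)) * Real.log (eNorm (D.T n *ᵥ x)))
        atTop (𝓝 (D.χ k)) := by
      refine (hx x hx0 (D.χ k) hmax ⟨k, hk, rfl⟩).congr fun n => ?_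
      ring
    refine ⟨⟨_, hlim⟩, fun i => ?_⟩
    rw [mem_sup hV, mem_sup hV]
    constructor
    · intro h
      have h1 : D.χ k = lam i := tendsto_nhds_unique hlim h
      constructor
      · intro j hj
        obtain ⟨i', hi'⟩ := hl1 j
        refine ⟨i', ?_, hi'⟩
        have := hmax j hj
        rw [h1, hi'] at this
        exact hanti.le_iff_ge.mp this
      · intro h2
        obtain ⟨j, hj, hj'⟩ := h2 k hk
        rw [h1] at hj'
        exact hj.ne (hanti.injective hj')
    · rintro ⟨h1, h2⟩
      convert hlim using 2
      push Not at h2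
      obtain ⟨k', hk', h3⟩ := h2
      obtain ⟨j, hj, hj'⟩ := h1 k' hk'
      have e : j = i := by
        rcases hj.lt_or_eq with h | h
        · exact absurd hj' (h3 j h)
        · exact h.symm
      obtain ⟨j2, hj2, hj2'⟩ := h1 k hk
      have := hmax k' hk'
      rw [hj', hj2', e] at this
      apply le_antisymm (hj2' ▸ this)
      rw [hj2']
      exact hanti.antitone hj2

end Spec
end MET

namespace MET
section Prob
variable {d : ℕ} {Ω : Type*} [MeasurableSpace Ω]

lemma meas_det {k : ℕ} (F : Ω → Matrix (Fin k) (Fin k) ℝ) (h : ∀ i j, Measurable fun ω => F ω i j) :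
    Measurable fun ω => (F ω).det := by
  simp only [Matrix.det_apply]
  refine Finset.measurable_fun_sum _ fun σ _ => ?_
  refine Measurable.const_smul ?_ _
  exact Finset.measurable_fun_prod _ fun i _ => h _ _

lemma meas_mnr (k : ℕ) (F : Ω → Matrix (Fin d) (Fin d) ℝ) (h : ∀ i j, Measurable fun ω => F ω i j) :
    Measurable fun ω => mnr k (F ω) := by
  unfold mnr
  refine Finset.measurable_fun_sum _ fun f _ => Finset.measurable_fun_sum _ fun g _ => ?_
  have := meas_det (fun ω => (F ω).submatrix f g) (fun i j => h _ _)
  exact continuous_abs.measurable.comp this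

lemma meas_nrm (F : Ω → Matrix (Fin d) (Fin d) ℝ) (h : ∀ i j, Measurable fun ω => F ω i j) :
    Measurable fun ω => nrm (F ω) := by
  unfold nrm
  exact Finset.measurable_fun_sum _ fun f _ => Finset.measurable_fun_sum _ fun g _ =>
    continuous_abs.measurable.comp (h _ _)

lemma meas_inv (F : Ω → Matrix (Fin d) (Fin d) ℝ) (h : ∀ i j, Measurable fun ω => F ω i j)
    (i j : Fin d) : Measurable fun ω => (F ω)⁻¹ i j := by
  have e : ∀ ω, (F ω)⁻¹ i j = ((F ω).det)⁻¹ * ((F ω).updateRow j (Pi.single i 1)).det := by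
    intro ω
    rw [Matrix.inv_def, Matrix.smul_apply, adjugate_apply, smul_eq_mul, Ring.inverse_eq_inv']
  simp only [e]
  refine (meas_det F h).inv.mul (meas_det _ fun a b => ?_)
  simp only [updateRow_apply]
  split_ifs
  · exact measurable_const
  · exact h a b

lemma entry_le_nrm (M : Matrix (Fin d) (Fin d) ℝ) (i j : Fin d) : |M i j| ≤ nrm M := by
  refine le_trans ?_ (Finset.single_le_sum (f := fun i => ∑ j, |M i j|)
    (fun i _ => Finset.sum_nonneg fun _ _ => abs_nonneg _) (Finset.mem_univ i))
  exact Finset.single_le_sum (f := fun j => |M i j|) (fun _ _ => abs_nonneg _) (Finset.mem_univ j)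

lemma nrm_le_op (M : Matrix (Fin d) (Fin d) ℝ) : nrm M ≤ (d:ℝ)^2 * opNorm M := by
  have hb : BddAbove (Set.range fun x : {x : Fin d → ℝ // eNorm x ≤ 1} =>
      eNorm (M *ᵥ (x : Fin d → ℝ))) := by
    refine ⟨nrm M, ?_⟩
    rintro _ ⟨x, rfl⟩
    refine (eNorm_mulVec_le _ _).trans ?_
    exact mul_le_of_le_one_right (nrm_nonneg M) x.2
  have h1 : ∀ i j, |M i j| ≤ opNorm M := by
    intro i j
    have hs : eNorm (Pi.single j 1 : Fin d → ℝ) ≤ 1 := by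
      refine (eNorm_le_sum _).trans ?_
      rw [Finset.sum_eq_single j]
      · simp
      · intro b _ hb; simp [hb]
      · simp
    have h2 := le_ciSup hb ⟨Pi.single j 1, hs⟩
    refine le_trans ?_ h2
    have h3 := abs_le_eNorm (M *ᵥ Pi.single j 1) i
    rw [mulVec_single_one] at h3
    simpa using h3
  calc nrm M ≤ ∑ i : Fin d, ∑ j : Fin d, opNorm M :=
        Finset.sum_le_sum fun i _ => Finset.sum_le_sum fun j _ => h1 i j
    _ = _ := by simp; ring

/-- positive log of the entry norm -/
def lp (M : Matrix (Fin d) (Fin d) ℝ) : ℝ := max (Real.log (nrm M)) 0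

lemma lp_nonneg (M : Matrix (Fin d) (Fin d) ℝ) : 0 ≤ lp M := le_max_right _ _

lemma nrm_le_exp (M : Matrix (Fin d) (Fin d) ℝ) : nrm M ≤ Real.exp (lp M) := by
  rcases (nrm_nonneg M).eq_or_lt with h | h
  · rw [← h]; exact (Real.exp_pos _).le
  · rw [← Real.log_le_iff_le_exp h]; exact le_max_left _ _

lemma lp_integrable (hd : 1 ≤ d) (μ : Measure Ω) [IsFiniteMeasure μ]
    (F : Ω → Matrix (Fin d) (Fin d) ℝ)
    (h : ∀ i j, Measurable fun ω => F ω i j)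
    (hi : Integrable (fun ω => max (Real.log (opNorm (F ω))) 0) μ) :
    Integrable (fun ω => lp (F ω)) μ := by
  have hm : Measurable fun ω => lp (F ω) := (Real.measurable_log.comp (meas_nrm F h)).max
    measurable_const
  refine Integrable.mono' ((integrable_const (Real.log ((d:ℝ)^2))).add hi)
    hm.aestronglyMeasurable (Eventually.of_forall fun ω => ?_)
  have hd' : (1:ℝ) ≤ (d:ℝ)^2 := one_le_pow₀ (by exact_mod_cast hd)
  have hl : 0 ≤ Real.log ((d:ℝ)^2) := Real.log_nonneg hd'
  rw [Real.norm_of_nonneg (lp_nonneg _)]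
  simp only [Pi.add_apply]
  have h0 := le_max_right (Real.log (opNorm (F ω))) 0
  refine max_le ?_ (by linarith)
  rcases (nrm_nonneg (F ω)).eq_or_lt with h | h
  · rw [← h, Real.log_zero]; linarith
  · have h1 := nrm_le_op (F ω)
    have h2 : 0 < opNorm (F ω) := by
      by_contra hc
      push Not at hc
      nlinarith
    have h3 := Real.log_le_log h h1
    rw [Real.log_mul (by positivity) h2.ne'] at h3
    linarith [le_max_left (Real.log (opNorm (F ω))) 0]

/-- setting: forward products and inverses -/
structure Cocy (T : Ω → Ω) (a b : Ω → Matrix (Fin d) (Fin d) ℝ)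
    (P Q : ℕ → Ω → Matrix (Fin d) (Fin d) ℝ) : Prop where
  P0 : ∀ ω, P 0 ω = 1
  P1 : ∀ ω, P 1 ω = a ω
  Q1 : ∀ ω, Q 1 ω = b ω
  PQ : ∀ n ω, P n ω * Q n ω = 1
  Padd : ∀ m n ω, P (m + n) ω = P n (T^[m] ω) * P m ω
  Qadd : ∀ m n ω, Q (m + n) ω = Q m ω * Q n (T^[m] ω)

variable {T : Ω → Ω} {a b : Ω → Matrix (Fin d) (Fin d) ℝ}
  {P Q : ℕ → Ω → Matrix (Fin d) (Fin d) ℝ}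

lemma Cocy.QP (H : Cocy T a b P Q) (n : ℕ) (ω : Ω) : Q n ω * P n ω = 1 :=
  mul_eq_one_comm.mp (H.PQ n ω)

lemma Cocy.meas (H : Cocy T a b P Q) (hT : Measurable T) (ha : ∀ i j, Measurable fun ω => a ω i j)
    (n : ℕ) : ∀ i j, Measurable fun ω => P n ω i j := by
  induction n with
  | zero => intro i j; simp only [H.P0]; exact measurable_const
  | succ n ih =>
    intro i j
    have e : ∀ ω, P (n+1) ω i j = ∑ l, P n (T ω) i l * a ω l j := by
      intro ω
      rw [add_comm, H.Padd 1 n, H.P1, Matrix.mul_apply]; rfl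
    simp only [e]
    exact Finset.measurable_fun_sum _ fun l _ => ((ih i l).comp hT).mul (ha l j)

lemma one_le_prod {k : ℕ} (hk : k ≤ d) {M N : Matrix (Fin d) (Fin d) ℝ} (h : M * N = 1) :
    1 ≤ mnr k M * mnr k N := by
  have := one_le_mnr_one k hk
  rw [← h] at this
  exact this.trans (mnr_mul k M N)

lemma mnr_pos {k : ℕ} (hk : k ≤ d) {M N : Matrix (Fin d) (Fin d) ℝ} (h : M * N = 1) :
    0 < mnr k M := by
  have h1 := one_le_prod hk h
  rcases (mnr_nonneg k M).eq_or_lt with h2 | h2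
  · rw [← h2] at h1; norm_num at h1
  · exact h2

/-- dominating function -/
def gk (k : ℕ) (a b : Ω → Matrix (Fin d) (Fin d) ℝ) (ω : Ω) : ℝ :=
  |Real.log (Cb d k)| + k * (lp (a ω) + lp (b ω))

lemma log_mnr_le {k : ℕ} (hk : k ≤ d) {M N : Matrix (Fin d) (Fin d) ℝ} (h : M * N = 1) :
    Real.log (mnr k M) ≤ |Real.log (Cb d k)| + k * lp M := by
  have h0 := mnr_pos hk h
  have h1 : mnr k M ≤ Cb d k * Real.exp (lp M) ^ k :=
    mnr_le k M _ fun i j => (entry_le_nrm M i j).trans (nrm_le_exp M)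
  have hC : 0 < Cb d k := by
    by_contra hc
    push Not at hc
    have := Real.exp_pos (lp M)
    have : 0 < Real.exp (lp M) ^ k := by positivity
    nlinarith
  have h2 := Real.log_le_log h0 h1
  rw [Real.log_mul hC.ne' (by positivity), ← Real.exp_nat_mul, Real.log_exp] at h2
  linarith [le_abs_self (Real.log (Cb d k))]

lemma log_mul_le {k : ℕ} (hk : k ≤ d) {M N M' N' : Matrix (Fin d) (Fin d) ℝ} (h : M * N = 1)
    (h' : M' * N' = 1) :
    Real.log (mnr k (M * M')) ≤ Real.log (mnr k M) + Real.log (mnr k M') := by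
  rw [← Real.log_mul (mnr_pos hk h).ne' (mnr_pos hk h').ne']
  refine Real.log_le_log ?_ (mnr_mul _ _ _)
  refine mnr_pos (N := N' * N) hk ?_
  rw [Matrix.mul_assoc, ← Matrix.mul_assoc M', h', Matrix.one_mul, h]

lemma Cocy.kingman (H : Cocy T a b P Q) (μ : Measure Ω) [IsFiniteMeasure μ]
    (hT : MeasurePreserving T μ μ)
    (ha : ∀ i j, Measurable fun ω => a ω i j) (hb : ∀ i j, Measurable fun ω => b ω i j)
    (hia : Integrable (fun ω => lp (a ω)) μ) (hib : Integrable (fun ω => lp (b ω)) μ)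
    (k : ℕ) (hk : k ≤ d) :
    ∀ᵐ ω ∂μ, ∃ l, Tendsto (fun n : ℕ => Real.log (mnr k (P n ω)) / n) atTop (𝓝 l) := by
  have hlm : ∀ c : Ω → Matrix (Fin d) (Fin d) ℝ, (∀ i j, Measurable fun ω => c ω i j) →
      Measurable fun ω => lp (c ω) := fun c hc =>
    (Real.measurable_log.comp (meas_nrm c hc)).max measurable_const
  have hga : ∀ x, |Real.log (Cb d k)| + k * lp (a x) ≤ gk k a b x := fun x => by
    unfold gk
    have := lp_nonneg (b x)
    gcongr; linarith
  have hgb : ∀ x, |Real.log (Cb d k)| + k * lp (b x) ≤ gk k a b x := fun x => by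
    unfold gk
    have := lp_nonneg (a x)
    gcongr; linarith
  have hab : ∀ x, a x * b x = 1 := fun x => by rw [← H.P1, ← H.Q1, H.PQ]
  have hba : ∀ x, b x * a x = 1 := fun x => by rw [← H.P1, ← H.Q1, H.QP]
  have hfa : ∀ x, Real.log (mnr k (P 1 x)) ≤ gk k a b x := fun x => by
    rw [H.P1]; exact (log_mnr_le hk (hab x)).trans (hga x)
  have hfb : ∀ x, Real.log (mnr k (Q 1 x)) ≤ gk k a b x := fun x => by
    rw [H.Q1]; exact (log_mnr_le hk (hba x)).trans (hgb x)
  have hsub : ∀ m n x, 1 ≤ m → 1 ≤ n → Real.log (mnr k (P (m+n) x)) ≤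
      Real.log (mnr k (P m x)) + Real.log (mnr k (P n (T^[m] x))) := fun m n x _ _ => by
    rw [H.Padd, add_comm]; exact log_mul_le hk (H.PQ _ _) (H.PQ _ _)
  have hsub' : ∀ m n x, 1 ≤ m → 1 ≤ n → Real.log (mnr k (Q (m+n) x)) ≤
      Real.log (mnr k (Q m x)) + Real.log (mnr k (Q n (T^[m] x))) := fun m n x _ _ => by
    rw [H.Qadd]; exact log_mul_le hk (H.QP _ _) (H.QP _ _)
  refine MET.kingman μ T hT (fun n ω => Real.log (mnr k (P n ω))) (gk k a b) ?_ ?_ ?_ ?_ hsub ?_ ?_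
  · unfold gk
    exact measurable_const.add (measurable_const.mul ((hlm a ha).add (hlm b hb)))
  · unfold gk
    exact (integrable_const _).add ((hia.add hib).const_mul _)
  · intro x; unfold gk
    have := lp_nonneg (a x)
    have := lp_nonneg (b x)
    positivity
  · intro n
    exact Real.measurable_log.comp (meas_mnr k _ (H.meas hT.measurable ha n))
  · intro n hn x
    have h1 := MET.le_sum T (fun n ω => Real.log (mnr k (P n ω))) (gk k a b) hsub hfa n hn x
    have h2 := MET.le_sum T (fun n ω => Real.log (mnr k (Q n ω))) (gk k a b) hsub' hfb n hn x
    have h3 := Real.log_nonneg (one_le_prod hk (H.PQ n x))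
    rw [Real.log_mul (mnr_pos hk (H.PQ n x)).ne' (mnr_pos hk (H.QP n x)).ne'] at h3
    rw [abs_le]; constructor <;> linarith
  · intro x n _
    have e1 : P (n+1) x = P n (T x) * P 1 x := by rw [add_comm, H.Padd 1 n]; rfl
    have e2 : P n (T x) = P (n+1) x * Q 1 x := by
      rw [e1, Matrix.mul_assoc, H.PQ, Matrix.mul_one]
    have h1 := log_mul_le hk (H.PQ n (T x)) (H.PQ 1 x)
    have h2 := log_mul_le hk (H.PQ (n+1) x) (H.QP 1 x)
    rw [← e1] at h1
    rw [← e2] at h2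
    have := hfa x
    have := hfb x
    rw [abs_le]; constructor <;> linarith

lemma RT_of_lp (F : ℕ → Matrix (Fin d) (Fin d) ℝ)
    (h : Tendsto (fun n : ℕ => lp (F n) / n) atTop (𝓝 0)) : RT (fun n => nrm (F n)) 0 := by
  have h1 : RT (fun n => Real.exp (lp (F n))) 0 :=
    RT.of_log (fun n => Real.exp_pos _) (by simpa using h)
  exact h1.of_le (Eventually.of_forall fun n => nrm_le_exp _)

/-- convergence of singular value exponents from that of minors -/
lemma sv_conv (hd : 1 ≤ d) (M U : ℕ → Matrix (Fin d) (Fin d) ℝ) (s : ℕ → Fin d → ℝ)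
    (hU : ∀ n, (U n)ᵀ * U n = 1) (hpos : ∀ n i, 0 < s n i) (hs : ∀ n, Antitone (s n))
    (h : ∀ n, (M n)ᵀ * M n = U n * diagonal (fun i => s n i ^ 2) * (U n)ᵀ)
    (hm : ∀ k, k ≤ d → ∃ l, Tendsto (fun n : ℕ => Real.log (mnr k (M n)) / n) atTop (𝓝 l))
    (i : Fin d) : ∃ l, Tendsto (fun n : ℕ => Real.log (s n i) / n) atTop (𝓝 l) := by
  have key : ∀ k (hk : k ≤ d), ∃ l, Tendsto
      (fun n : ℕ => (∑ i : Fin k, Real.log (s n (Fin.castLE hk i))) / n) atTop (𝓝 l) := by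
    intro k hk
    obtain ⟨l, hl⟩ := hm k hk
    refine ⟨l, ?_⟩
    have hC : 0 < Cb d k := by
      unfold Cb
      have : (0:ℝ) < d := by exact_mod_cast hd
      positivity
    have hb : ∀ n, |(∑ i : Fin k, Real.log (s n (Fin.castLE hk i))) - Real.log (mnr k (M n))| ≤
        3 * |Real.log (Cb d k)| := by
      intro n
      obtain ⟨h1, h2⟩ := svd_mnr (M n) (U n) (s n) (hU n) (hpos n) (hs n) (h n) k hk
      have hp : 0 < ∏ i : Fin k, s n (Fin.castLE hk i) := Finset.prod_pos fun i _ => hpos n _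
      have hm0 : 0 < mnr k (M n) := by
        by_contra hc
        push Not at hc
        have : 0 < Cb d k ^ 2 := by positivity
        nlinarith
      have h1' := Real.log_le_log hm0 h1
      have h2' := Real.log_le_log hp h2
      rw [Real.log_mul (by positivity) hp.ne', Real.log_pow] at h1'
      rw [Real.log_mul (by positivity) hm0.ne', Real.log_pow] at h2'
      rw [Real.log_prod (fun i _ => (hpos n _).ne')] at h1' h2'
      push_cast at h1' h2'
      have := le_abs_self (Real.log (Cb d k))
      have := abs_nonneg (Real.log (Cb d k))
      rw [abs_le]; constructor <;> linarith
    have hz : Tendsto (fun n : ℕ => ((∑ i : Fin k, Real.log (s n (Fin.castLE hk i))) -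
        Real.log (mnr k (M n))) / n) atTop (𝓝 0) := by
      refine squeeze_zero_norm (a := fun n : ℕ => (3 * |Real.log (Cb d k)|) / n) (fun n => ?_)
        (tendsto_const_div_atTop_nhds_zero_nat _)
      rw [norm_div, Real.norm_eq_abs, Real.norm_natCast]
      exact div_le_div_of_nonneg_right (hb n) (by positivity)
    have := hz.add hl
    rw [zero_add] at this
    exact this.congr fun n => by ring
  obtain ⟨l1, h1⟩ := key i.1 i.2.le
  obtain ⟨l2, h2⟩ := key (i.1+1) i.2
  refine ⟨l2 - l1, (h2.sub h1).congr fun n => ?_⟩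
  rw [Fin.sum_univ_castSucc, ← sub_div]
  congr 1
  have e : Fin.castLE i.2 (Fin.last i.1) = i := by ext; simp
  rw [e]
  have : ∀ j : Fin i.1, Fin.castLE (m := d) i.2 (Fin.castSucc j) = Fin.castLE i.2.le j := fun j => by
    ext; simp
  simp only [this]; ring

lemma Cocy.data (H : Cocy T a b P Q) (hd : 1 ≤ d) (μ : Measure Ω) [IsFiniteMeasure μ]
    (hT : MeasurePreserving T μ μ)
    (ha : ∀ i j, Measurable fun ω => a ω i j) (hb : ∀ i j, Measurable fun ω => b ω i j)
    (hia : Integrable (fun ω => lp (a ω)) μ) (hib : Integrable (fun ω => lp (b ω)) μ) :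
    ∀ᵐ ω ∂μ, ∃ D : Data d, D.T = fun n => P n ω := by
  have hlm : ∀ c : Ω → Matrix (Fin d) (Fin d) ℝ, (∀ i j, Measurable fun ω => c ω i j) →
      Measurable fun ω => lp (c ω) := fun c hc =>
    (Real.measurable_log.comp (meas_nrm c hc)).max measurable_const
  have hk : ∀ᵐ ω ∂μ, ∀ k, k ≤ d →
      ∃ l, Tendsto (fun n : ℕ => Real.log (mnr k (P n ω)) / n) atTop (𝓝 l) := by
    rw [ae_all_iff]
    intro k
    by_cases h : k ≤ d
    · filter_upwards [H.kingman μ hT ha hb hia hib k h] with ω hω _ using hω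
    · exact Eventually.of_forall fun ω h' => absurd h' h
  filter_upwards [hk, iter_div μ T hT _ (hlm a ha) hia, iter_div μ T hT _ (hlm b hb) hib]
    with ω h1 h2 h3
  have hunit : ∀ n, IsUnit (P n ω).det := fun n => by
    have := congrArg Matrix.det (H.PQ n ω)
    rw [det_mul, det_one] at this
    exact IsUnit.of_mul_eq_one _ this
  choose U s hU hpos hs hsvd using fun n => svd_exists (P n ω) (hunit n)
  choose χ hχ using sv_conv hd (fun n => P n ω) U s hU hpos hs hsvd h1
  have hPs : ∀ n, P (n+1) ω = a (T^[n] ω) * P n ω := fun n => by rw [H.Padd, H.P1]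
  have hba : ∀ x, b x * a x = 1 := fun x => by rw [← H.P1, ← H.Q1, H.QP]
  exact ⟨{ T := fun n => P n ω
           U := U
           s := s
           A := fun n => a (T^[n] ω)
           B := fun n => b (T^[n] ω)
           χ := χ
           hU := hU
           hpos := hpos
           hsvd := hsvd
           hA := hPs
           hB := fun n => by
            rw [hPs, ← Matrix.mul_assoc, hba, Matrix.one_mul]
           rA := RT_of_lp _ h2
           rB := RT_of_lp _ h3
           hχ := hχ }, rfl⟩

end Prob
end MET


/-- MET for a discrete-time linear cocycle, parts (i) and (iii): for `ℙ`-a.e. `ω` the limit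
`Φ(ω) = lim_{n→∞} (φ(n,ω)ᵀ φ(n,ω))^{1/(2n)}` exists as a symmetric positive-definite matrix
(the `(1/(2n))`-th root being encoded by the unique symmetric positive-definite `(2n)`-th
roots `R n`); `Φ(ω)` has distinct eigenvalues `e^{λ_1} > ⋯ > e^{λ_p}` with eigenspaces
`U_1, …, U_p`; setting `V_i = U_p ⊕ ⋯ ⊕ U_i`, for every `x ≠ 0` the Lyapunov exponent
`λ(ω,x) = lim_{n→∞} (1/n) log |φ(n,ω)x|` exists and equals `λ_i` iff
`x ∈ V_i ∖ V_{i+1}`. -/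
theorem discrete_MET_lyapunov_spectrum
    {d : ℕ} (hd : 1 ≤ d)
    {Ω : Type*} [MeasurableSpace Ω] (ℙ : Measure Ω) [IsProbabilityMeasure ℙ]
    (θ : Equiv.Perm Ω) (hθmeas : Measurable (θ : Ω → Ω))
    (hθinv : Measurable (θ.symm : Ω → Ω))
    (hθpres : MeasurePreserving (θ : Ω → Ω) ℙ ℙ)
    (A : Ω → GL (Fin d) ℝ)
    (hA : ∀ i j, Measurable fun ω => (A ω : Matrix (Fin d) (Fin d) ℝ) i j)
    (φ : ℤ → Ω → GL (Fin d) ℝ)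
    (hφ0 : ∀ ω, φ 0 ω = 1)
    (hφ1 : ∀ ω, φ 1 ω = A ω)
    (hφc : ∀ (m n : ℤ) (ω : Ω), φ (m + n) ω = φ m ((θ ^ n) ω) * φ n ω)
    (hint₁ : Integrable
      (fun ω => max (Real.log (opNorm (A ω : Matrix (Fin d) (Fin d) ℝ))) 0) ℙ)
    (hint₂ : Integrable
      (fun ω => max (Real.log (opNorm (((A ω)⁻¹ : GL (Fin d) ℝ) : Matrix (Fin d) (Fin d) ℝ))) 0)
      ℙ) :
    ∀ᵐ ω ∂ℙ, ∃ Φ : Matrix (Fin d) (Fin d) ℝ, Φ.IsSymm ∧ Φ.PosDef ∧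
      (∃ R : ℕ → Matrix (Fin d) (Fin d) ℝ,
        (∀ n : ℕ, 1 ≤ n → (R n).IsSymm ∧ (R n).PosDef ∧
          R n ^ (2 * n) =
            ((φ (n : ℤ) ω : Matrix (Fin d) (Fin d) ℝ))ᵀ *
              ((φ (n : ℤ) ω : Matrix (Fin d) (Fin d) ℝ))) ∧
        Tendsto R atTop (𝓝 Φ)) ∧
      ∃ (p : ℕ) (lam : Fin p → ℝ), StrictAnti lam ∧
        -- the distinct eigenvalues of `Φ` are exactly `e^{lam 0} > ⋯ > e^{lam (p-1)}`
        (∀ μ : ℝ,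
          Module.End.eigenspace (Matrix.toLin' Φ) μ ≠ ⊥ ↔ ∃ i : Fin p, μ = Real.exp (lam i)) ∧
        -- with `U i` the eigenspace of `e^{lam i}` and `V i = U (p-1) ⊕ ⋯ ⊕ U i`:
        (∀ x : Fin d → ℝ, x ≠ 0 →
          (∃ l : ℝ,
            Tendsto
              (fun n : ℕ =>
                (1 / (n : ℝ)) *
                  Real.log (eNorm ((φ (n : ℤ) ω : Matrix (Fin d) (Fin d) ℝ) *ᵥ x)))
              atTop (𝓝 l)) ∧
          ∀ i : Fin p,
            (Tendsto
              (fun n : ℕ =>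
                (1 / (n : ℝ)) *
                  Real.log (eNorm ((φ (n : ℤ) ω : Matrix (Fin d) (Fin d) ℝ) *ᵥ x)))
              atTop (𝓝 (lam i)) ↔
            ((x ∈ ⨆ j : Fin p, ⨆ _ : i ≤ j,
                Module.End.eigenspace (Matrix.toLin' Φ) (Real.exp (lam j))) ∧
              x ∉ ⨆ j : Fin p, ⨆ _ : i < j,
                Module.End.eigenspace (Matrix.toLin' Φ) (Real.exp (lam j))))) := by
  have hinv : ∀ M : GL (Fin d) ℝ, (M : Matrix (Fin d) (Fin d) ℝ) *
      ((M⁻¹ : GL (Fin d) ℝ) : Matrix (Fin d) (Fin d) ℝ) = 1 := fun M => by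
    rw [← Units.val_mul, mul_inv_cancel, Units.val_one]
  have hpow : ∀ (m : ℕ) (ω : Ω), (θ ^ (m : ℤ)) ω = (θ : Ω → Ω)^[m] ω := fun m ω => by
    rw [zpow_natCast, Equiv.Perm.iterate_eq_pow]
  have hadd : ∀ (m n : ℕ) (ω : Ω),
      φ ((m + n : ℕ) : ℤ) ω = φ (n : ℤ) ((θ : Ω → Ω)^[m] ω) * φ (m : ℤ) ω := fun m n ω => by
    rw [← hpow, ← hφc]; congr 1; push_cast; ring
  have H : MET.Cocy (θ : Ω → Ω) (fun ω => (A ω : Matrix (Fin d) (Fin d) ℝ))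
      (fun ω => (((A ω)⁻¹ : GL (Fin d) ℝ) : Matrix (Fin d) (Fin d) ℝ))
      (fun n ω => (φ (n : ℤ) ω : Matrix (Fin d) (Fin d) ℝ))
      (fun n ω => (((φ (n : ℤ) ω)⁻¹ : GL (Fin d) ℝ) : Matrix (Fin d) (Fin d) ℝ)) :=
    { P0 := fun ω => by simp [hφ0]
      P1 := fun ω => by simp [hφ1]
      Q1 := fun ω => by simp [hφ1]
      PQ := fun n ω => hinv _
      Padd := fun m n ω => by rw [hadd, Units.val_mul]
      Qadd := fun m n ω => by rw [hadd, _root_.mul_inv_rev, Units.val_mul] }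
  have hB : ∀ i j, Measurable fun ω =>
      (((A ω)⁻¹ : GL (Fin d) ℝ) : Matrix (Fin d) (Fin d) ℝ) i j := fun i j => by
    simp only [Matrix.coe_units_inv]
    exact MET.meas_inv _ hA i j
  filter_upwards [H.data hd ℙ hθpres hA hB (MET.lp_integrable hd ℙ _ hA hint₁)
    (MET.lp_integrable hd ℙ _ hB hint₂)] with ω hω
  obtain ⟨D, hD⟩ := hω
  have := MET.final D
  simp only [hD] at this
  exact this
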